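/- Let 0 < p < ∞, q = ∞, and 0 < u, v ≤ ∞, and set ℓ(k,n) = k / log(n/k + 1). Then there exist constants c, C > 0 depending only on p, u, v such that for all n ∈ ℕ: (i) for 1 ≤ k ≤ log(n+1), c ≤ e_k(id: ℓ_{p,u}^n → ℓ_{∞,v}^n) ≤ C; (ii) for log(n+1) ≤ k ≤ n, c · ℓ(k,n)^{−1/p} (log(ℓ(k,n)+1))^{1/v} ≤ e_k(id: ℓ_{p,u}^n → ℓ_{∞,v}^n) ≤ C · ℓ(k,n)^{−1/p} (log(ℓ(k,n)+1))^{1/v}; (iii) for k ≥ n, c · 2^{−k/n} n^{−1/p} (log(n+1))^{1/v} ≤ e_k(id: ℓ_{p,u}^n → ℓ_{∞,v}^n) ≤ C · 2^{−k/n} n^{−1/p} (log(n+1))^{1/v}. -/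

import Mathlib

open scoped ENNReal Classical
open MeasureTheory

/-- The non-increasing rearrangement of `x : ℝ^n`: for `1 ≤ i ≤ n`,
`rearr n x i` is the `i`-th largest of the absolute values of the entries of `x`,
defined via `x_i^* = inf {t ≥ 0 : #{j : |x j| > t} ≤ i - 1}`. -/
noncomputable def rearr (n : ℕ) (x : Fin n → ℝ) (i : ℕ) : ℝ :=
  sInf {t : ℝ | 0 ≤ t ∧ ((Finset.univ : Finset (Fin n)).filter (fun j => t < |x j|)).card ≤ i - 1}

/-- The Lorentz quasi-norm `‖x‖_{p,u}` on `ℝ^n` for `p, u ∈ (0,∞]`, with the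
convention `1/∞ = 0`:  `‖x‖_{p,u} = (∑_{i=1}^n i^{u/p-1} (x_i^*)^u)^{1/u}` for `u < ∞`
and `‖x‖_{p,∞} = max_{1 ≤ i ≤ n} i^{1/p} x_i^*`. -/
noncomputable def lorentzNorm (n : ℕ) (p u : ℝ≥0∞) (x : Fin n → ℝ) : ℝ :=
  if u = ⊤ then
    sSup {t : ℝ | ∃ i ∈ Finset.Icc 1 n, t = (i : ℝ) ^ (1 / p).toReal * rearr n x i}
  else
    (∑ i ∈ Finset.Icc 1 n, (i : ℝ) ^ ((u / p).toReal - 1) * rearr n x i ^ u.toReal) ^ (1 / u.toReal)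

/-- The `k`-th (dyadic) entropy number of the identity map from `(ℝ^n, NX)` to `(ℝ^n, NY)`:
`e_k = inf {ε > 0 : ∃ y_1, …, y_{2^{k-1}} with B_X ⊆ ⋃ (y_i + ε B_Y)}`. -/
noncomputable def entropyNumber (n : ℕ) (NX NY : (Fin n → ℝ) → ℝ) (k : ℕ) : ℝ :=
  sInf {ε : ℝ | 0 < ε ∧ ∃ T : Finset (Fin n → ℝ), T.card ≤ 2 ^ (k - 1) ∧
    ∀ x : Fin n → ℝ, NX x ≤ 1 → ∃ y ∈ T, NY (x - y) ≤ ε}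

/-- The operator norm of the identity map from `(ℝ^n, NX)` to `(ℝ^n, NY)`:
`‖id‖ = sup {NY x : NX x ≤ 1}`. -/
noncomputable def opNorm (n : ℕ) (NX NY : (Fin n → ℝ) → ℝ) : ℝ :=
  sSup {t : ℝ | ∃ x : Fin n → ℝ, NX x ≤ 1 ∧ t = NY x}

theorem rearr_nonneg (n : ℕ) (x : Fin n → ℝ) (i : ℕ) : 0 ≤ rearr n x i :=
  Real.sInf_nonneg fun _ ht => ht.1

theorem rearr_le {n : ℕ} {x : Fin n → ℝ} {i : ℕ} {t : ℝ} (ht : 0 ≤ t)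
    (h : ((Finset.univ : Finset (Fin n)).filter (fun j => t < |x j|)).card ≤ i - 1) :
    rearr n x i ≤ t :=
  csInf_le ⟨0, fun _ hs => hs.1⟩ ⟨ht, h⟩

theorem rearr_set_nonempty (n : ℕ) (x : Fin n → ℝ) (i : ℕ) :
    {t : ℝ | 0 ≤ t ∧
      ((Finset.univ : Finset (Fin n)).filter (fun j => t < |x j|)).card ≤ i - 1}.Nonempty := by
  refine ⟨∑ j, |x j|, Finset.sum_nonneg fun _ _ => abs_nonneg _, ?_⟩
  rw [Finset.filter_false_of_mem, Finset.card_empty]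
  · exact Nat.zero_le _
  · intro j _
    exact not_lt.2 (Finset.single_le_sum (f := fun j => |x j|) (fun _ _ => abs_nonneg _)
      (Finset.mem_univ j))

theorem le_rearr {n : ℕ} {x : Fin n → ℝ} {i : ℕ} {t : ℝ} (hi : 1 ≤ i)
    (h : i ≤ ((Finset.univ : Finset (Fin n)).filter (fun j => t ≤ |x j|)).card) :
    t ≤ rearr n x i := by
  refine le_csInf (rearr_set_nonempty n x i) fun s hs => ?_
  by_contra! hst
  have := Finset.card_le_card (Finset.monotone_filter_right (Finset.univ : Finset (Fin n))
    (p := fun j => t ≤ |x j|) (q := fun j => s < |x j|) fun j _ hj => lt_of_lt_of_le hst hj)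
  have := hs.2
  omega

theorem rearr_mono {n : ℕ} {x y : Fin n → ℝ} (h : ∀ j, |x j| ≤ |y j|) (i : ℕ) :
    rearr n x i ≤ rearr n y i := by
  refine csInf_le_csInf ⟨0, fun _ hs => hs.1⟩ (rearr_set_nonempty n y i) fun t ht => ⟨ht.1, ?_⟩
  exact (Finset.card_le_card (Finset.monotone_filter_right _
    fun j _ hj => lt_of_lt_of_le hj (h j))).trans ht.2

theorem rearr_antitone {n : ℕ} (x : Fin n → ℝ) {i j : ℕ} (h : i ≤ j) :
    rearr n x j ≤ rearr n x i :=
  csInf_le_csInf ⟨0, fun _ hs => hs.1⟩ (rearr_set_nonempty n x i)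
    fun _ ht => ⟨ht.1, ht.2.trans (by omega)⟩

theorem rearr_le_of_abs_le {n : ℕ} {x : Fin n → ℝ} {t : ℝ} (ht : 0 ≤ t) (h : ∀ j, |x j| ≤ t)
    (i : ℕ) : rearr n x i ≤ t := by
  refine rearr_le ht ?_
  rw [Finset.filter_false_of_mem fun j _ => not_lt.2 (h j), Finset.card_empty]
  exact Nat.zero_le _

theorem rearr_eq_zero {n : ℕ} {x : Fin n → ℝ} {m i : ℕ}
    (h : ((Finset.univ : Finset (Fin n)).filter (fun j => x j ≠ 0)).card ≤ m) (hi : m < i) :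
    rearr n x i = 0 := by
  refine le_antisymm (rearr_le le_rfl ?_) (rearr_nonneg _ _ _)
  simp only [abs_pos]
  omega

theorem exists_perm_rearr (n : ℕ) (x : Fin n → ℝ) :
    ∃ σ : Equiv.Perm (Fin n), ∀ i : Fin n, rearr n x (i + 1) = |x (σ i)| := by
  let σ := Tuple.sort (fun j => -|x j|)
  have hσ : ∀ i j : Fin n, i ≤ j → |x (σ j)| ≤ |x (σ i)| := by
    intro i j hij
    have := Tuple.monotone_sort (fun j => -|x j|) hij
    simpa using this
  refine ⟨σ, fun i => le_antisymm ?_ ?_⟩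
  · refine rearr_le (abs_nonneg _) ?_
    have : (Finset.univ.filter (fun j => |x (σ i)| < |x j|)) ⊆ (Finset.Iio i).image σ := by
      intro j hj
      simp only [Finset.mem_filter, Finset.mem_univ, true_and] at hj
      refine Finset.mem_image.2 ⟨σ.symm j, ?_, by simp⟩
      rw [Finset.mem_Iio]
      by_contra! hc
      have := hσ _ _ hc
      rw [Equiv.apply_symm_apply] at this
      linarith
    have h2 := (Finset.card_le_card this).trans Finset.card_image_le
    simpa using h2
  · refine le_rearr (by omega) ?_
    have : (Finset.Iic i).image σ ⊆ (Finset.univ.filter (fun j => |x (σ i)| ≤ |x j|)) := by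
      intro j hj
      obtain ⟨a, ha, rfl⟩ := Finset.mem_image.1 hj
      simpa using hσ _ _ (Finset.mem_Iic.1 ha)
    have h2 := Finset.card_le_card this
    rw [Finset.card_image_of_injective _ σ.injective] at h2
    simpa using h2

theorem sum_Icc_eq_sum_fin (n : ℕ) (g : ℕ → ℝ) :
    ∑ i ∈ Finset.Icc 1 n, g i = ∑ i : Fin n, g (i + 1) := by
  rw [Fin.sum_univ_eq_sum_range (fun i => g (i + 1)) n, Finset.range_eq_Ico,
    Finset.sum_Ico_add' g 0 n 1]
  simp only [Finset.Ico_add_one_right_eq_Icc, zero_add]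

theorem sum_comp_rearr (n : ℕ) (x : Fin n → ℝ) (F : ℝ → ℝ) :
    ∑ i ∈ Finset.Icc 1 n, F (rearr n x i) = ∑ j, F |x j| := by
  obtain ⟨σ, hσ⟩ := exists_perm_rearr n x
  rw [sum_Icc_eq_sum_fin n (fun i => F (rearr n x i)),
    ← Equiv.sum_comp σ (fun j => F |x j|)]
  exact Finset.sum_congr rfl fun i _ => by rw [hσ]

theorem rpow_le_mul_sum {s : ℝ} (hs : 0 < s) (m : ℕ) :
    (m : ℝ) ^ s ≤ max 1 s * ∑ i ∈ Finset.Icc 1 m, (i : ℝ) ^ (s - 1) := by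
  induction m with
  | zero => simp [Real.zero_rpow hs.ne']
  | succ m ih =>
    rw [Finset.sum_Icc_succ_top (by omega), mul_add]
    have hy : (0 : ℝ) < m + 1 := by positivity
    have e1 : (m : ℝ) ^ s = (m + 1 : ℝ) ^ s * (1 + -(1 / (m + 1 : ℝ))) ^ s := by
      rw [← Real.mul_rpow hy.le]
      · congr 1; field_simp; ring
      · have : 1 / (m + 1 : ℝ) ≤ 1 := by rw [div_le_one hy]; linarith [Nat.cast_nonneg (α := ℝ) m]
        linarith
    have e2 : (m + 1 : ℝ) ^ s = (m + 1 : ℝ) ^ (s - 1) * (m + 1) := by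
      rw [← Real.rpow_add_one hy.ne']; simp
    have h1 : 1 / (m + 1 : ℝ) ≤ 1 := by rw [div_le_one hy]; linarith [Nat.cast_nonneg (α := ℝ) m]
    have key : 1 - max 1 s * (1 / (m + 1 : ℝ)) ≤ (1 + -(1 / (m + 1 : ℝ))) ^ s := by
      rcases le_total 1 s with h | h
      · rw [max_eq_right h]
        have := one_add_mul_self_le_rpow_one_add (s := -(1 / (m + 1 : ℝ))) (by linarith) h
        linarith
      · rw [max_eq_left h]
        have := Real.rpow_le_rpow_of_exponent_ge' (x := 1 + -(1 / (m + 1 : ℝ))) (by linarith)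
          (by have : 0 ≤ 1 / (m + 1 : ℝ) := by positivity
              linarith) hs.le h
        rw [Real.rpow_one] at this
        linarith
    have h3 := mul_le_mul_of_nonneg_left key (Real.rpow_nonneg hy.le s)
    rw [← e1] at h3
    have h4 : (m + 1 : ℝ) ^ s * (1 - max 1 s * (1 / (m + 1 : ℝ)))
        = (m + 1 : ℝ) ^ s - max 1 s * (m + 1 : ℝ) ^ (s - 1) := by
      rw [e2]; field_simp
    push_cast
    linarith

theorem sum_rpow_le {s : ℝ} (hs : 0 < s) (m : ℕ) :
    ∑ i ∈ Finset.Icc 1 m, (i : ℝ) ^ (s - 1) ≤ max 1 (1 / s) * (m : ℝ) ^ s := by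
  induction m with
  | zero => simp [Real.zero_rpow hs.ne']
  | succ m ih =>
    rw [Finset.sum_Icc_succ_top (by omega)]
    have hy : (0 : ℝ) < m + 1 := by positivity
    have h1 : 1 / (m + 1 : ℝ) ≤ 1 := by rw [div_le_one hy]; linarith [Nat.cast_nonneg (α := ℝ) m]
    have h0 : 0 < 1 / (m + 1 : ℝ) := by positivity
    have e1 : (m : ℝ) ^ s = (m + 1 : ℝ) ^ s * (1 + -(1 / (m + 1 : ℝ))) ^ s := by
      rw [← Real.mul_rpow hy.le (by linarith)]
      congr 1; field_simp; ring
    have e2 : (m + 1 : ℝ) ^ s = (m + 1 : ℝ) ^ (s - 1) * (m + 1) := by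
      rw [← Real.rpow_add_one hy.ne']; simp
    have hM : 0 < max 1 (1 / s) := by positivity
    have key : 1 / (m + 1 : ℝ) ≤ max 1 (1 / s) * (1 - (1 + -(1 / (m + 1 : ℝ))) ^ s) := by
      rcases le_total 1 s with h | h
      · rw [max_eq_left ((div_le_one hs).2 h)]
        have := Real.rpow_le_rpow_of_exponent_ge' (x := 1 + -(1 / (m + 1 : ℝ))) (by linarith)
          (by linarith) zero_le_one h
        rw [Real.rpow_one] at this
        linarith
      · rw [max_eq_right ((one_le_div hs).2 h)]
        have := rpow_one_add_le_one_add_mul_self (s := -(1 / (m + 1 : ℝ))) (by linarith)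
          hs.le h
        rw [div_mul_eq_mul_div, le_div_iff₀ hs]
        linarith
    have h3 := mul_le_mul_of_nonneg_left key (Real.rpow_nonneg hy.le s)
    have h4 : (m + 1 : ℝ) ^ s * (1 / (m + 1 : ℝ)) = (m + 1 : ℝ) ^ (s - 1) := by
      rw [e2]; field_simp
    have h5 : (m + 1 : ℝ) ^ s * (max 1 (1 / s) * (1 - (1 + -(1 / (m + 1 : ℝ))) ^ s))
        = max 1 (1 / s) * (m + 1 : ℝ) ^ s - max 1 (1 / s) * (m : ℝ) ^ s := by
      rw [e1]; ring
    push_cast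
    linarith

theorem sum_rpow_neg_tail_le {s : ℝ} (hs : 0 < s) {a : ℕ} (ha : 1 ≤ a) (n : ℕ) :
    ∑ i ∈ Finset.Ioc a n, (i : ℝ) ^ (-1 - s) ≤ 1 / s * (a : ℝ) ^ (-s) := by
  rcases lt_or_ge n a with h | h
  · rw [Finset.Ioc_eq_empty (by omega), Finset.sum_empty]; positivity
  suffices H : ∑ i ∈ Finset.Ioc a n, (i : ℝ) ^ (-1 - s) ≤
      1 / s * ((a : ℝ) ^ (-s) - (n : ℝ) ^ (-s)) by
    refine H.trans (mul_le_mul_of_nonneg_left ?_ (by positivity))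
    linarith [Real.rpow_nonneg (Nat.cast_nonneg (α := ℝ) n) (-s)]
  induction n, h using Nat.le_induction with
  | base => simp
  | succ m hm ih =>
    rw [Finset.sum_Ioc_succ_top hm]
    have hm0 : (0 : ℝ) < m := by exact_mod_cast (by omega : 0 < m)
    have hy : (0 : ℝ) < m + 1 := by positivity
    have e1 : (m : ℝ) ^ (-s) = (m + 1 : ℝ) ^ (-s) * (((m + 1) / m : ℝ)) ^ s := by
      rw [Real.div_rpow hy.le hm0.le, Real.rpow_neg hm0.le, Real.rpow_neg hy.le]
      field_simp
    have h1 : 1 + s * (1 / (m + 1 : ℝ)) ≤ ((m + 1) / m : ℝ) ^ s := by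
      rw [Real.rpow_def_of_pos (by positivity)]
      have h2 := Real.add_one_le_exp (Real.log ((m + 1) / m) * s)
      have h3 := Real.one_sub_inv_le_log_of_pos (x := ((m + 1) / m : ℝ)) (by positivity)
      have h4 : 1 - ((m + 1) / m : ℝ)⁻¹ = 1 / (m + 1 : ℝ) := by field_simp; ring
      rw [h4] at h3
      have := mul_le_mul_of_nonneg_left h3 hs.le
      linarith
    have h3 := mul_le_mul_of_nonneg_left h1 (Real.rpow_nonneg hy.le (-s))
    rw [← e1] at h3
    have e2 : (m + 1 : ℝ) ^ (-1 - s) = (m + 1 : ℝ) ^ (-s) * (1 / (m + 1 : ℝ)) := by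
      rw [show -1 - s = -s - 1 by ring, Real.rpow_sub_one hy.ne']; ring
    push_cast
    rw [e2]
    have h6 : (m + 1 : ℝ) ^ (-s) * (1 / (m + 1 : ℝ)) ≤
      1 / s * ((m : ℝ) ^ (-s) - (m + 1 : ℝ) ^ (-s)) := by
      rw [div_mul_eq_mul_div, le_div_iff₀ hs]
      linarith
    linarith

theorem lorentzNorm_top_top (n : ℕ) (x : Fin n → ℝ) :
    lorentzNorm n ⊤ ⊤ x = sSup {t : ℝ | ∃ i ∈ Finset.Icc 1 n, t = rearr n x i} := by
  simp [lorentzNorm]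

theorem lorentzNorm_top_of_ne_top (n : ℕ) {v : ℝ≥0∞} (hv : v ≠ ⊤) (x : Fin n → ℝ) :
    lorentzNorm n ⊤ v x =
      (∑ i ∈ Finset.Icc 1 n, (i : ℝ)⁻¹ * rearr n x i ^ v.toReal) ^ (1 / v.toReal) := by
  simp [lorentzNorm, hv, Real.rpow_neg_one]

theorem bddAbove_exists_mem_eq (s : Finset ℕ) (g : ℕ → ℝ) :
    BddAbove {t : ℝ | ∃ i ∈ s, t = g i} := by
  refine (s.finite_toSet.image g).bddAbove.mono ?_
  rintro t ⟨i, hi, rfl⟩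
  exact ⟨i, hi, rfl⟩

theorem log_le_sum_inv (n : ℕ) :
    Real.log ((n : ℝ) + 1) ≤ ∑ i ∈ Finset.Icc 1 n, (i : ℝ)⁻¹ := by
  have h := log_add_one_le_harmonic n
  rw [harmonic_eq_sum_Icc] at h
  push_cast at h
  exact h

theorem sum_inv_le_log (n : ℕ) :
    ∑ i ∈ Finset.Icc 1 n, (i : ℝ)⁻¹ ≤ 1 + Real.log n := by
  have h := harmonic_le_one_add_log n
  rw [harmonic_eq_sum_Icc] at h
  push_cast at h
  exact h

/-- Upper estimate of the target norm of a vector whose rearrangement is dominated by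
`K * min (L ^ (-α)) (i ^ (-α))`. -/
theorem exists_lorentzNorm_top_le {α : ℝ} (hα : 0 < α) {v : ℝ≥0∞} (hv : 0 < v) :
    ∃ C : ℝ, 0 < C ∧ ∀ (n : ℕ) (L K : ℝ) (r : Fin n → ℝ), 1 ≤ L → 0 ≤ K →
      (∀ i ∈ Finset.Icc 1 n, rearr n r i ≤ K * L ^ (-α)) →
      (∀ i ∈ Finset.Icc 1 n, rearr n r i ≤ K * (i : ℝ) ^ (-α)) →
      lorentzNorm n ⊤ v r ≤ C * K * (L ^ (-α) * Real.log (L + 1) ^ (1 / v).toReal) := by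
  by_cases hvt : v = ⊤
  · subst hvt
    refine ⟨1, one_pos, fun n L K r hL hK h1 _ => ?_⟩
    rw [lorentzNorm_top_top]
    simp only [one_div, ENNReal.inv_top, ENNReal.toReal_zero, Real.rpow_zero, mul_one, one_mul]
    refine Real.sSup_le ?_ (by positivity)
    rintro t ⟨i, hi, rfl⟩
    exact h1 i hi
  have hV : 0 < v.toReal := ENNReal.toReal_pos hv.ne' hvt
  set V := v.toReal with hVdef
  have hs : 0 < α * V := by positivity
  set s := α * V with hsdef
  have hl2 : 0 < Real.log 2 := Real.log_pos (by norm_num)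
  set C0 : ℝ := (1 + 2 ^ s / s) / Real.log 2 + 1 with hC0
  have hC0p : 0 < C0 := by positivity
  refine ⟨C0 ^ (1 / V), by positivity, fun n L K r hL hK h1 h2 => ?_⟩
  have hL0 : 0 < L := by linarith
  rw [lorentzNorm_top_of_ne_top n hvt, ← hVdef]
  have hv1 : (1 / v).toReal = 1 / V := by simp [hVdef]
  rw [hv1]
  have hlogL : Real.log 2 ≤ Real.log (L + 1) := Real.log_le_log (by norm_num) (by linarith)
  have hlogp : 0 < Real.log (L + 1) := by linarith
  have ha1 : 1 ≤ ⌊L⌋₊ := Nat.le_floor (by simpa using hL)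
  set a := ⌊L⌋₊ with ha
  have haL : (a : ℝ) ≤ L := Nat.floor_le hL0.le
  have haL' : L / 2 ≤ a := by
    have := Nat.lt_floor_add_one L
    have : (1 : ℝ) ≤ a := by exact_mod_cast ha1
    linarith
  have key : ∑ i ∈ Finset.Icc 1 n, (i : ℝ)⁻¹ * rearr n r i ^ V ≤
      C0 * K ^ V * (L ^ (-s) * Real.log (L + 1)) := by
    have hA : ∑ i ∈ (Finset.Icc 1 n).filter (· ≤ a), (i : ℝ)⁻¹ * rearr n r i ^ V ≤
        K ^ V * (L ^ (-s) * (1 + Real.log (L + 1))) := by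
      calc ∑ i ∈ (Finset.Icc 1 n).filter (· ≤ a), (i : ℝ)⁻¹ * rearr n r i ^ V
          ≤ ∑ i ∈ (Finset.Icc 1 n).filter (· ≤ a), (i : ℝ)⁻¹ * (K ^ V * L ^ (-s)) := by
            refine Finset.sum_le_sum fun i hi => ?_
            have hi' := (Finset.mem_filter.1 hi).1
            refine mul_le_mul_of_nonneg_left ?_ (by positivity)
            refine (Real.rpow_le_rpow (rearr_nonneg _ _ _) (h1 i hi') hV.le).trans_eq ?_
            rw [Real.mul_rpow hK (by positivity), ← Real.rpow_mul hL0.le, hsdef, neg_mul]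
        _ ≤ ∑ i ∈ Finset.Icc 1 a, (i : ℝ)⁻¹ * (K ^ V * L ^ (-s)) := by
            refine Finset.sum_le_sum_of_subset_of_nonneg ?_ fun i _ _ => by positivity
            intro i hi
            simp only [Finset.mem_filter, Finset.mem_Icc] at hi ⊢
            omega
        _ = K ^ V * (L ^ (-s) * ∑ i ∈ Finset.Icc 1 a, (i : ℝ)⁻¹) := by
            rw [← Finset.sum_mul]; ring
        _ ≤ K ^ V * (L ^ (-s) * (1 + Real.log (L + 1))) := by
            gcongr
            refine (sum_inv_le_log a).trans ?_
            have : Real.log a ≤ Real.log (L + 1) :=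
              Real.log_le_log (by exact_mod_cast ha1) (by linarith)
            linarith
    have hB : ∑ i ∈ (Finset.Icc 1 n).filter (¬ · ≤ a), (i : ℝ)⁻¹ * rearr n r i ^ V ≤
        K ^ V * (L ^ (-s) * (2 ^ s / s)) := by
      calc ∑ i ∈ (Finset.Icc 1 n).filter (¬ · ≤ a), (i : ℝ)⁻¹ * rearr n r i ^ V
          ≤ ∑ i ∈ (Finset.Icc 1 n).filter (¬ · ≤ a), K ^ V * (i : ℝ) ^ (-1 - s) := by
            refine Finset.sum_le_sum fun i hi => ?_
            have hi' := (Finset.mem_filter.1 hi).1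
            have hi0 : (0 : ℝ) < i := by exact_mod_cast (Finset.mem_Icc.1 hi').1
            calc (i : ℝ)⁻¹ * rearr n r i ^ V ≤ (i : ℝ)⁻¹ * (K * (i : ℝ) ^ (-α)) ^ V := by
                  gcongr
                  · exact rearr_nonneg _ _ _
                  · exact h2 i hi'
              _ = K ^ V * (i : ℝ) ^ (-1 - s) := by
                  rw [Real.mul_rpow hK (by positivity), ← Real.rpow_mul hi0.le, sub_eq_add_neg,
                    Real.rpow_add hi0, Real.rpow_neg_one, hsdef, neg_mul]
                  ring
        _ ≤ ∑ i ∈ Finset.Ioc a n, K ^ V * (i : ℝ) ^ (-1 - s) := by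
            refine Finset.sum_le_sum_of_subset_of_nonneg ?_ fun i _ _ => by positivity
            intro i hi
            simp only [Finset.mem_filter, Finset.mem_Icc, Finset.mem_Ioc] at hi ⊢
            omega
        _ = K ^ V * ∑ i ∈ Finset.Ioc a n, (i : ℝ) ^ (-1 - s) := by rw [Finset.mul_sum]
        _ ≤ K ^ V * (1 / s * (a : ℝ) ^ (-s)) := by
            gcongr
            exact sum_rpow_neg_tail_le hs ha1 n
        _ ≤ K ^ V * (1 / s * (L / 2) ^ (-s)) := by
            gcongr K ^ V * (1 / s * ?_)
            exact Real.rpow_le_rpow_of_nonpos (by positivity) haL' (by linarith)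
        _ = K ^ V * (L ^ (-s) * (2 ^ s / s)) := by
            rw [Real.div_rpow hL0.le (by norm_num), Real.rpow_neg (by norm_num : (0 : ℝ) ≤ 2)]
            field_simp
    rw [← Finset.sum_filter_add_sum_filter_not _ (· ≤ a)]
    calc _ ≤ K ^ V * (L ^ (-s) * (1 + Real.log (L + 1))) + K ^ V * (L ^ (-s) * (2 ^ s / s)) :=
          add_le_add hA hB
      _ = K ^ V * (L ^ (-s) * ((1 + 2 ^ s / s) + Real.log (L + 1))) := by ring
      _ ≤ K ^ V * (L ^ (-s) * (C0 * Real.log (L + 1))) := by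
          gcongr
          rw [hC0, add_mul, one_mul, div_mul_eq_mul_div]
          gcongr
          rw [le_div_iff₀ hl2]
          gcongr
      _ = _ := by ring
  calc _ ≤ (C0 * K ^ V * (L ^ (-s) * Real.log (L + 1))) ^ (1 / V) := by
        refine Real.rpow_le_rpow (Finset.sum_nonneg fun i _ => ?_) key (by positivity)
        have := rearr_nonneg n r i
        positivity
    _ = _ := by
        rw [Real.mul_rpow (by positivity) (by positivity), Real.mul_rpow (by positivity)
          (by positivity), Real.mul_rpow (by positivity) hlogp.le, ← Real.rpow_mul hK,
          ← Real.rpow_mul hL0.le, mul_one_div_cancel hV.ne', Real.rpow_one, hsdef]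
        congr 3
        field_simp

theorem log_one_add_le_rpow {V : ℝ} (hV : 0 < V) {t : ℝ} (ht : 1 ≤ t) :
    Real.log (1 + t) ≤ 2 ^ V / V * t ^ V := by
  calc Real.log (1 + t) ≤ (1 + t) ^ V / V := Real.log_le_rpow_div (by linarith) hV
    _ ≤ (2 * t) ^ V / V := by gcongr; linarith
    _ = _ := by rw [Real.mul_rpow (by norm_num) (by linarith)]; ring

/-- The logarithmic weight of a vector is controlled by its target norm. -/
theorem exists_sum_log_le {v : ℝ≥0∞} (hv : 0 < v) :
    ∃ C : ℝ, 0 < C ∧ ∀ (n : ℕ) (R : ℝ) (z : Fin n → ℝ), 0 < n → 0 < R →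
      lorentzNorm n ⊤ v z ≤ R * Real.log ((n : ℝ) + 1) ^ (1 / v).toReal →
      ∑ j, Real.log (1 + |z j| / R) ≤ C * n := by
  by_cases hvt : v = ⊤
  · subst hvt
    refine ⟨1, one_pos, fun n R z hn hR h => ?_⟩
    rw [lorentzNorm_top_top] at h
    simp only [one_div, ENNReal.inv_top, ENNReal.toReal_zero, Real.rpow_zero, mul_one] at h
    rw [← sum_comp_rearr n z (fun t => Real.log (1 + t / R))]
    calc _ ≤ ∑ i ∈ Finset.Icc 1 n, (1 : ℝ) := by
          refine Finset.sum_le_sum fun i hi => ?_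
          have h1 : rearr n z i ≤ R := (le_csSup (bddAbove_exists_mem_eq _ _) ⟨i, hi, rfl⟩).trans h
          have h2 : rearr n z i / R ≤ 1 := (div_le_one hR).2 h1
          have h3 : 0 ≤ rearr n z i / R := div_nonneg (rearr_nonneg _ _ _) hR.le
          have := Real.log_le_sub_one_of_pos (show 0 < 1 + rearr n z i / R by linarith)
          linarith
      _ = 1 * n := by simp
  have hV : 0 < v.toReal := ENNReal.toReal_pos hv.ne' hvt
  set V := v.toReal with hVdef
  have hv1 : (1 / v).toReal = 1 / V := by simp [hVdef]
  refine ⟨2 ^ V / V + 1, by positivity, fun n R z hn hR h => ?_⟩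
  rw [lorentzNorm_top_of_ne_top n hvt, ← hVdef, hv1] at h
  have hn1 : (1 : ℝ) ≤ n := by exact_mod_cast hn
  have hlog : 0 < Real.log ((n : ℝ) + 1) := Real.log_pos (by linarith)
  set H := ∑ i ∈ Finset.Icc 1 n, (i : ℝ)⁻¹ with hH
  have hHl : Real.log ((n : ℝ) + 1) ≤ H := log_le_sum_inv n
  have hS0 : 0 ≤ ∑ i ∈ Finset.Icc 1 n, (i : ℝ)⁻¹ * rearr n z i ^ V :=
    Finset.sum_nonneg fun i _ => mul_nonneg (by positivity)
      (Real.rpow_nonneg (rearr_nonneg _ _ _) _)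
  have h1 : ∑ i ∈ Finset.Icc 1 n, (i : ℝ)⁻¹ * rearr n z i ^ V ≤ R ^ V * H := by
    have h2 := Real.rpow_le_rpow (Real.rpow_nonneg hS0 _) h hV.le
    rw [← Real.rpow_mul hS0, one_div_mul_cancel hV.ne', Real.rpow_one,
      Real.mul_rpow hR.le (by positivity), ← Real.rpow_mul hlog.le, one_div_mul_cancel hV.ne',
      Real.rpow_one] at h2
    exact h2.trans (by gcongr)
  have hcheb : H * ∑ i ∈ Finset.Icc 1 n, rearr n z i ^ V ≤
      n * ∑ i ∈ Finset.Icc 1 n, (i : ℝ)⁻¹ * rearr n z i ^ V := by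
    have hm : MonovaryOn (fun i : ℕ => (i : ℝ)⁻¹) (fun i => rearr n z i ^ V)
        (Finset.Icc 1 n : Finset ℕ) := by
      intro i hi j hj hij
      have hji : j ≤ i := by
        by_contra! hc
        exact absurd (Real.rpow_le_rpow (rearr_nonneg n z j) (rearr_antitone z hc.le) hV.le)
          (not_le.2 hij)
      have hj0 : (0 : ℝ) < j := by
        exact_mod_cast (Finset.mem_Icc.1 (Finset.mem_coe.1 hj)).1
      have : (j : ℝ) ≤ i := by exact_mod_cast hji
      exact inv_anti₀ hj0 this
    have := hm.sum_mul_sum_le_card_mul_sum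
    simpa using this
  have hHp : 0 < H := by linarith
  have hsum : ∑ i ∈ Finset.Icc 1 n, rearr n z i ^ V ≤ n * R ^ V := by
    refine le_of_mul_le_mul_left (hcheb.trans ?_) hHp
    calc _ ≤ (n : ℝ) * (R ^ V * H) := by gcongr
      _ = _ := by ring
  rw [← sum_comp_rearr n z (fun t => Real.log (1 + t / R))]
  calc ∑ i ∈ Finset.Icc 1 n, Real.log (1 + rearr n z i / R)
      ≤ ∑ i ∈ Finset.Icc 1 n, (1 + 2 ^ V / V / R ^ V * rearr n z i ^ V) := by
        refine Finset.sum_le_sum fun i _ => ?_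
        have h0 := rearr_nonneg n z i
        have h3 : 0 ≤ rearr n z i / R := div_nonneg h0 hR.le
        rcases le_total 1 (rearr n z i / R) with hc | hc
        · have := log_one_add_le_rpow hV hc
          rw [Real.div_rpow h0 hR.le] at this
          calc _ ≤ _ := this
            _ = 2 ^ V / V / R ^ V * rearr n z i ^ V := by ring
            _ ≤ _ := by linarith
        · have := Real.log_le_sub_one_of_pos (show 0 < 1 + rearr n z i / R by linarith)
          have : 0 ≤ 2 ^ V / V / R ^ V * rearr n z i ^ V := by positivity
          linarith
    _ = n + 2 ^ V / V / R ^ V * ∑ i ∈ Finset.Icc 1 n, rearr n z i ^ V := by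
        rw [Finset.sum_add_distrib, ← Finset.mul_sum]; simp
    _ ≤ n + 2 ^ V / V / R ^ V * (n * R ^ V) := by gcongr
    _ = (2 ^ V / V + 1) * n := by
        have : R ^ V ≠ 0 := by positivity
        field_simp
        ring

theorem mul_log_card_le_lorentzNorm_top {v : ℝ≥0∞} (hv : 0 < v) {n N : ℕ} (z : Fin n → ℝ) {t : ℝ}
    (ht : 0 < t) (hN : 1 ≤ N)
    (hcard : N = ((Finset.univ : Finset (Fin n)).filter (fun j => t ≤ |z j|)).card) :
    t * Real.log ((N : ℝ) + 1) ^ (1 / v).toReal ≤ lorentzNorm n ⊤ v z := by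
  have hNn : N ≤ n := by
    rw [hcard]; exact (Finset.card_le_univ _).trans_eq (Fintype.card_fin n)
  have hr : ∀ i ∈ Finset.Icc 1 N, t ≤ rearr n z i := fun i hi =>
    le_rearr (Finset.mem_Icc.1 hi).1 (hcard ▸ (Finset.mem_Icc.1 hi).2)
  by_cases hvt : v = ⊤
  · subst hvt
    rw [lorentzNorm_top_top]
    simp only [one_div, ENNReal.inv_top, ENNReal.toReal_zero, Real.rpow_zero, mul_one]
    exact (hr 1 (by simp [hN])).trans
      (le_csSup (bddAbove_exists_mem_eq _ _) ⟨1, by simp; omega, rfl⟩)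
  have hV : 0 < v.toReal := ENNReal.toReal_pos hv.ne' hvt
  have hv1 : (1 / v).toReal = 1 / v.toReal := by simp
  rw [lorentzNorm_top_of_ne_top n hvt, hv1]
  have hlog : 0 ≤ Real.log ((N : ℝ) + 1) := Real.log_nonneg (by linarith [N.cast_nonneg (α := ℝ)])
  calc t * Real.log ((N : ℝ) + 1) ^ (1 / v.toReal)
      = (t ^ v.toReal * Real.log ((N : ℝ) + 1)) ^ (1 / v.toReal) := by
        rw [Real.mul_rpow (by positivity) hlog, ← Real.rpow_mul ht.le, mul_one_div_cancel hV.ne',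
          Real.rpow_one]
    _ ≤ _ := by
        refine Real.rpow_le_rpow (by positivity) ?_ (by positivity)
        calc t ^ v.toReal * Real.log ((N : ℝ) + 1)
            ≤ t ^ v.toReal * ∑ i ∈ Finset.Icc 1 N, (i : ℝ)⁻¹ := by
              gcongr; exact log_le_sum_inv N
          _ = ∑ i ∈ Finset.Icc 1 N, (i : ℝ)⁻¹ * t ^ v.toReal := by
              rw [← Finset.sum_mul]; ring
          _ ≤ ∑ i ∈ Finset.Icc 1 N, (i : ℝ)⁻¹ * rearr n z i ^ v.toReal := by
              refine Finset.sum_le_sum fun i hi => ?_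
              have := hr i hi
              gcongr
          _ ≤ _ := by
              refine Finset.sum_le_sum_of_subset_of_nonneg
                (Finset.Icc_subset_Icc le_rfl hNn) fun i _ _ => ?_
              have := rearr_nonneg n z i
              positivity

theorem exists_rearr_le {p u : ℝ≥0∞} (hp : 0 < p) (hp' : p ≠ ⊤) (hu : 0 < u) :
    ∃ K : ℝ, 0 < K ∧ ∀ (n : ℕ) (x : Fin n → ℝ), lorentzNorm n p u x ≤ 1 →
      ∀ i ∈ Finset.Icc 1 n, rearr n x i ≤ K * (i : ℝ) ^ (-(1 / p).toReal) := by
  have hα : 0 < (1 / p).toReal := by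
    have := ENNReal.toReal_pos hp.ne' hp'
    simp only [one_div, ENNReal.toReal_inv]; positivity
  set α := (1 / p).toReal with hαd
  by_cases hut : u = ⊤
  · refine ⟨1, one_pos, fun n x hx i hi => ?_⟩
    have hi0 : (0 : ℝ) < i := by exact_mod_cast (Finset.mem_Icc.1 hi).1
    simp only [lorentzNorm, hut, if_true] at hx
    have h := (le_csSup (bddAbove_exists_mem_eq (Finset.Icc 1 n)
      (fun i : ℕ => (i : ℝ) ^ α * rearr n x i)) ⟨i, hi, rfl⟩).trans hx
    rw [Real.rpow_neg hi0.le, ← div_eq_mul_inv, le_div_iff₀ (by positivity)]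
    linarith
  have hU : 0 < u.toReal := ENNReal.toReal_pos hu.ne' hut
  set U := u.toReal with hUd
  have hup : (u / p).toReal = α * U := by
    rw [hαd, hUd, ENNReal.toReal_div, ENNReal.toReal_div]; simp; ring
  have hs : 0 < α * U := by positivity
  set M := max 1 (α * U)
  have hM : 0 < M := by positivity
  refine ⟨M ^ (1 / U), by positivity, fun n x hx i hi => ?_⟩
  have hi0 : (0 : ℝ) < i := by exact_mod_cast (Finset.mem_Icc.1 hi).1
  simp only [lorentzNorm, hut, if_false, hup] at hx
  rw [← hUd] at hx
  have hr := rearr_nonneg n x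
  have hS0 : 0 ≤ ∑ i ∈ Finset.Icc 1 n, (i : ℝ) ^ (α * U - 1) * rearr n x i ^ U :=
    Finset.sum_nonneg fun i _ => mul_nonneg (by positivity) (Real.rpow_nonneg (hr i) _)
  have h1 : ∑ i ∈ Finset.Icc 1 n, (i : ℝ) ^ (α * U - 1) * rearr n x i ^ U ≤ 1 := by
    have h2 := Real.rpow_le_rpow (Real.rpow_nonneg hS0 _) hx hU.le
    rwa [← Real.rpow_mul hS0, one_div_mul_cancel hU.ne', Real.rpow_one, Real.one_rpow] at h2
  have h2 : (∑ j ∈ Finset.Icc 1 i, (j : ℝ) ^ (α * U - 1)) * rearr n x i ^ U ≤ 1 := by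
    refine le_trans ?_ h1
    rw [Finset.sum_mul]
    refine (Finset.sum_le_sum fun j hj => ?_).trans (Finset.sum_le_sum_of_subset_of_nonneg
      (Finset.Icc_subset_Icc le_rfl (Finset.mem_Icc.1 hi).2) fun j _ _ =>
        mul_nonneg (by positivity) (Real.rpow_nonneg (hr j) _))
    refine mul_le_mul_of_nonneg_left ?_ (by positivity)
    exact Real.rpow_le_rpow (hr i) (rearr_antitone x (Finset.mem_Icc.1 hj).2) hU.le
  have h3 : (i : ℝ) ^ (α * U) * rearr n x i ^ U ≤ M := by
    calc _ ≤ (M * ∑ j ∈ Finset.Icc 1 i, (j : ℝ) ^ (α * U - 1)) * rearr n x i ^ U :=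
          mul_le_mul_of_nonneg_right (rpow_le_mul_sum hs i) (Real.rpow_nonneg (hr i) _)
      _ = M * ((∑ j ∈ Finset.Icc 1 i, (j : ℝ) ^ (α * U - 1)) * rearr n x i ^ U) := by ring
      _ ≤ M * 1 := by gcongr
      _ = M := mul_one M
  have h4 := Real.rpow_le_rpow (mul_nonneg (by positivity) (Real.rpow_nonneg (hr i) _)) h3
    (one_div_nonneg.2 hU.le)
  rw [Real.mul_rpow (by positivity) (Real.rpow_nonneg (hr i) _), ← Real.rpow_mul hi0.le,
    ← Real.rpow_mul (hr i), mul_one_div_cancel hU.ne', Real.rpow_one, mul_assoc,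
    mul_one_div_cancel hU.ne', mul_one] at h4
  rw [Real.rpow_neg hi0.le, ← div_eq_mul_inv, le_div_iff₀ (by positivity)]
  linarith

theorem exists_lorentzNorm_le {p u : ℝ≥0∞} (hp : 0 < p) (hp' : p ≠ ⊤) (hu : 0 < u) :
    ∃ K : ℝ, 0 < K ∧ ∀ (n m : ℕ) (x : Fin n → ℝ) (t : ℝ), 0 ≤ t → (∀ j, |x j| ≤ t) →
      ((Finset.univ : Finset (Fin n)).filter (fun j => x j ≠ 0)).card ≤ m →
      lorentzNorm n p u x ≤ K * (m : ℝ) ^ (1 / p).toReal * t := by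
  have hα : 0 < (1 / p).toReal := by
    have := ENNReal.toReal_pos hp.ne' hp'
    simp only [one_div, ENNReal.toReal_inv]; positivity
  set α := (1 / p).toReal with hαd
  by_cases hut : u = ⊤
  · refine ⟨1, one_pos, fun n m x t ht hx hm => ?_⟩
    simp only [lorentzNorm, hut, if_true]
    refine Real.sSup_le ?_ (by positivity)
    rintro _ ⟨i, hi, rfl⟩
    rw [← hαd]
    rcases le_or_gt i m with h | h
    · rw [one_mul]
      exact mul_le_mul (Real.rpow_le_rpow (by positivity) (by exact_mod_cast h) hα.le)
        (rearr_le_of_abs_le ht hx i) (rearr_nonneg _ _ _) (by positivity)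
    · rw [rearr_eq_zero hm h, mul_zero]; positivity
  have hU : 0 < u.toReal := ENNReal.toReal_pos hu.ne' hut
  set U := u.toReal with hUd
  have hup : (u / p).toReal = α * U := by
    rw [hαd, hUd, ENNReal.toReal_div, ENNReal.toReal_div]; simp; ring
  have hs : 0 < α * U := by positivity
  set M := max 1 (1 / (α * U))
  have hM : 0 < M := by positivity
  refine ⟨M ^ (1 / U), by positivity, fun n m x t ht hx hm => ?_⟩
  have hr := rearr_nonneg n x
  simp only [lorentzNorm, hut, if_false, hup]
  rw [← hUd]
  calc _ ≤ (M * (m : ℝ) ^ (α * U) * t ^ U) ^ (1 / U) := by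
        refine Real.rpow_le_rpow (Finset.sum_nonneg fun i _ => mul_nonneg (by positivity)
          (Real.rpow_nonneg (hr i) _)) ?_ (by positivity)
        calc ∑ i ∈ Finset.Icc 1 n, (i : ℝ) ^ (α * U - 1) * rearr n x i ^ U
            ≤ ∑ i ∈ (Finset.Icc 1 n).filter (· ≤ m), (i : ℝ) ^ (α * U - 1) * t ^ U := by
              rw [Finset.sum_filter]
              refine Finset.sum_le_sum fun i _ => ?_
              split_ifs with h
              · refine mul_le_mul_of_nonneg_left ?_ (by positivity)
                exact Real.rpow_le_rpow (hr i) (rearr_le_of_abs_le ht hx i) hU.le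
              · rw [rearr_eq_zero hm (not_le.1 h), Real.zero_rpow hU.ne', mul_zero]
          _ ≤ ∑ i ∈ Finset.Icc 1 m, (i : ℝ) ^ (α * U - 1) * t ^ U := by
              refine Finset.sum_le_sum_of_subset_of_nonneg ?_ fun i _ _ => by positivity
              intro i hi
              simp only [Finset.mem_filter, Finset.mem_Icc] at hi ⊢
              omega
          _ ≤ _ := by
              rw [← Finset.sum_mul]
              gcongr
              exact sum_rpow_le hs m
    _ = _ := by
        rw [Real.mul_rpow (by positivity) (by positivity), Real.mul_rpow (by positivity)
          (by positivity), ← Real.rpow_mul (by positivity), ← Real.rpow_mul ht,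
          mul_one_div_cancel hU.ne', Real.rpow_one, mul_assoc α, mul_one_div_cancel hU.ne', mul_one]

/-- Exponential-moment bound for the number of functions of small total weight. -/
theorem card_le_exp_mul_prod {ι β : Type*} [Fintype ι] (S : Finset (ι → β)) (w : ι → β → ℝ)
    (M Q : ℝ) (hM : ∀ f ∈ S, ∑ j, w j (f j) ≤ M)
    (hQ : ∀ (j : ι) (A : Finset β), ∑ a ∈ A, Real.exp (-w j a) ≤ Q) :
    (S.card : ℝ) ≤ Real.exp M * Q ^ Fintype.card ι := by
  let A : ι → Finset β := fun j => S.image (fun f => f j)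
  have hSA : S ⊆ Fintype.piFinset A := fun f hf =>
    Fintype.mem_piFinset.2 fun j => Finset.mem_image_of_mem _ hf
  calc (S.card : ℝ) = ∑ f ∈ S, (1 : ℝ) := by simp
    _ ≤ ∑ f ∈ S, Real.exp M * ∏ j, Real.exp (-w j (f j)) := by
        refine Finset.sum_le_sum fun f hf => ?_
        rw [← Real.exp_sum, ← Real.exp_add]
        refine Real.one_le_exp ?_
        rw [Finset.sum_neg_distrib]
        linarith [hM f hf]
    _ ≤ ∑ f ∈ Fintype.piFinset A, Real.exp M * ∏ j, Real.exp (-w j (f j)) :=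
        Finset.sum_le_sum_of_subset_of_nonneg hSA fun f _ _ => by positivity
    _ = Real.exp M * ∏ j, ∑ a ∈ A j, Real.exp (-w j a) := by
        rw [← Finset.mul_sum, Finset.prod_univ_sum]
    _ ≤ Real.exp M * ∏ _j : ι, Q := by
        gcongr with j
        exact hQ j _
    _ = _ := by simp

theorem sum_inv_sq_le {D : ℝ} (hD : 0 < D) (c : ℤ) (A : Finset ℤ) :
    ∑ a ∈ A, Real.exp (-(2 * Real.log (1 + |(a : ℝ) - c| / D))) ≤ 1 + 2 * D := by
  have hterm : ∀ a : ℤ, Real.exp (-(2 * Real.log (1 + |(a : ℝ) - c| / D))) =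
      ((1 + |(a : ℝ) - c| / D) ^ 2)⁻¹ := fun a => by
    have : 0 < 1 + |(a : ℝ) - c| / D := by positivity
    rw [Real.exp_neg, two_mul, Real.exp_add, Real.exp_log this, sq]
  simp only [hterm]
  have hN : ∀ N : ℕ, ∑ a ∈ Finset.Icc (c - N) (c + N), ((1 + |(a : ℝ) - c| / D) ^ 2)⁻¹ ≤
      1 + 2 * (D - D / (1 + N / D)) := by
    intro N
    induction N with
    | zero => simp
    | succ N ih =>
      have hset : Finset.Icc (c - ((N + 1 : ℕ) : ℤ)) (c + ((N + 1 : ℕ) : ℤ)) =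
          insert (c - (N + 1)) (insert (c + (N + 1)) (Finset.Icc (c - N) (c + N))) := by
        ext a
        simp only [Finset.mem_insert, Finset.mem_Icc]
        push_cast
        omega
      rw [hset, Finset.sum_insert, Finset.sum_insert]
      · have e1 : |((c - (N + 1) : ℤ) : ℝ) - c| = N + 1 := by
          push_cast
          rw [show (c : ℝ) - (N + 1) - c = -((N : ℝ) + 1) by ring, abs_neg, abs_of_pos]
          positivity
        have e2 : |((c + (N + 1) : ℤ) : ℝ) - c| = N + 1 := by
          push_cast
          rw [show (c : ℝ) + (N + 1) - c = (N : ℝ) + 1 by ring, abs_of_pos]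
          positivity
        rw [e1, e2]
        have key : ((1 + ((N : ℝ) + 1) / D) ^ 2)⁻¹ ≤
            D / (1 + N / D) - D / (1 + ((N : ℝ) + 1) / D) := by
          have hP : 0 < 1 + (N : ℝ) / D := by positivity
          have hR : 0 < 1 + ((N : ℝ) + 1) / D := by positivity
          have : D / (1 + N / D) - D / (1 + ((N : ℝ) + 1) / D) =
              ((1 + (N : ℝ) / D) * (1 + ((N : ℝ) + 1) / D))⁻¹ := by
            rw [div_sub_div _ _ hP.ne' hR.ne', div_eq_mul_inv]
            have : D * (1 + ((N : ℝ) + 1) / D) - (1 + N / D) * D = 1 := by field_simp; ring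
            rw [this, one_mul]
          rw [this]
          apply inv_anti₀ (by positivity)
          rw [sq]
          gcongr
          linarith
        push_cast
        linarith
      · simp only [Finset.mem_Icc]; omega
      · simp only [Finset.mem_insert, Finset.mem_Icc]; omega
  obtain ⟨N, hN'⟩ : ∃ N : ℕ, A ⊆ Finset.Icc (c - N) (c + N) := by
    refine ⟨∑ a ∈ A, (a - c).natAbs, fun a ha => ?_⟩
    have h1 := Finset.single_le_sum (f := fun a : ℤ => (a - c).natAbs)
      (fun _ _ => Nat.zero_le _) ha
    rw [Finset.mem_Icc]
    omega
  calc _ ≤ ∑ a ∈ Finset.Icc (c - N) (c + N), ((1 + |(a : ℝ) - c| / D) ^ 2)⁻¹ :=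
        Finset.sum_le_sum_of_subset_of_nonneg hN' fun a _ _ => by positivity
    _ ≤ _ := hN N
    _ ≤ _ := by
        have : 0 ≤ D / (1 + N / D) := by positivity
        linarith

theorem card_le_of_log_weight {n : ℕ} {D M : ℝ} (hD : 0 < D) (c : Fin n → ℤ)
    (S : Finset (Fin n → ℤ)) (hS : ∀ f ∈ S, ∑ j, Real.log (1 + |(f j : ℝ) - c j| / D) ≤ M) :
    (S.card : ℝ) ≤ Real.exp (2 * M) * (1 + 2 * D) ^ n := by
  have := card_le_exp_mul_prod S (fun j a => 2 * Real.log (1 + |(a : ℝ) - c j| / D)) (2 * M)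
    (1 + 2 * D) (fun f hf => by rw [← Finset.mul_sum]; linarith [hS f hf])
    (fun j A => sum_inv_sq_le hD (c j) A)
  simpa using this

theorem card_le_of_log_weight_sparse {n : ℕ} {M q : ℝ} (hq : 2 ≤ q)
    (S : Finset (Fin n → ℤ)) (hS : ∀ f ∈ S, ∑ j, Real.log (1 + |(f j : ℝ)|) ≤ M) :
    (S.card : ℝ) ≤ Real.exp (q * M + 12 * Real.exp (-(q * Real.log 2)) * n) := by
  have hQ : ∀ A : Finset ℤ, ∑ a ∈ A, Real.exp (-(q * Real.log (1 + |(a : ℝ)|))) ≤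
      Real.exp (12 * Real.exp (-(q * Real.log 2))) := by
    intro A
    set κ := Real.exp (-((q - 2) * Real.log 2)) with hκ
    have hκ4 : κ = 4 * Real.exp (-(q * Real.log 2)) := by
      rw [hκ, show -((q - 2) * Real.log 2) = Real.log 2 + Real.log 2 + -(q * Real.log 2) by ring,
        Real.exp_add, Real.exp_add, Real.exp_log (by norm_num)]
      ring
    calc ∑ a ∈ A, Real.exp (-(q * Real.log (1 + |(a : ℝ)|)))
        ≤ ∑ a ∈ A, ((if a = 0 then 1 else 0) +
            κ * Real.exp (-(2 * Real.log (1 + |(a : ℝ) - (0 : ℤ)| / 1)))) := by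
          refine Finset.sum_le_sum fun a _ => ?_
          split_ifs with h
          · simp only [h, Int.cast_zero, abs_zero, add_zero, Real.log_one, mul_zero, neg_zero,
              Real.exp_zero]
            have : 0 ≤ κ * Real.exp (-(2 * Real.log (1 + |(0 : ℝ) - 0| / 1))) := by positivity
            linarith
          · rw [zero_add, Int.cast_zero, sub_zero, div_one, hκ, ← Real.exp_add]
            refine Real.exp_le_exp.2 ?_
            have h1 : (1 : ℝ) ≤ |(a : ℝ)| := by exact_mod_cast Int.one_le_abs h
            have h2 : Real.log 2 ≤ Real.log (1 + |(a : ℝ)|) :=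
              Real.log_le_log (by norm_num) (by linarith)
            nlinarith
      _ ≤ 1 + κ * (1 + 2 * 1) := by
          rw [Finset.sum_add_distrib, ← Finset.mul_sum]
          refine add_le_add ?_ ?_
          · rw [Finset.sum_ite_eq' A 0 (fun _ => (1 : ℝ))]
            split_ifs <;> norm_num
          · exact mul_le_mul_of_nonneg_left (sum_inv_sq_le one_pos 0 A) (Real.exp_pos _).le
      _ ≤ _ := by
          have := Real.add_one_le_exp (12 * Real.exp (-(q * Real.log 2)))
          rw [hκ4]
          linarith
  have := card_le_exp_mul_prod S (fun _ a => q * Real.log (1 + |(a : ℝ)|)) (q * M) _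
    (fun f hf => by rw [← Finset.mul_sum]; exact mul_le_mul_of_nonneg_left (hS f hf) (by linarith))
    (fun _ A => hQ A)
  refine this.trans_eq ?_
  rw [Fintype.card_fin, ← Real.exp_nat_mul, ← Real.exp_add]
  ring_nf

theorem finite_log_weight_le {n : ℕ} {D : ℝ} (hD : 0 < D) (M : ℝ) :
    {f : Fin n → ℤ | ∑ j, Real.log (1 + |(f j : ℝ)| / D) ≤ M}.Finite := by
  refine (Fintype.piFinset fun _ : Fin n =>
    Finset.Icc (-⌈D * Real.exp M⌉) ⌈D * Real.exp M⌉).finite_toSet.subset fun f hf => ?_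
  rw [Finset.mem_coe, Fintype.mem_piFinset]
  intro j
  have h0 : ∀ j, 0 ≤ Real.log (1 + |(f j : ℝ)| / D) := fun j =>
    Real.log_nonneg (by have : 0 ≤ |(f j : ℝ)| / D := by positivity
                        linarith)
  have h1 : Real.log (1 + |(f j : ℝ)| / D) ≤ M :=
    (Finset.single_le_sum (f := fun j => Real.log (1 + |(f j : ℝ)| / D)) (fun j _ => h0 j)
      (Finset.mem_univ j)).trans hf
  have hpos : 0 < 1 + |(f j : ℝ)| / D := by positivity
  rw [Real.log_le_iff_le_exp hpos] at h1
  have h2 : |(f j : ℝ)| / D ≤ Real.exp M := by linarith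
  rw [div_le_iff₀ hD] at h2
  have h3 : |(f j : ℝ)| ≤ (⌈D * Real.exp M⌉ : ℝ) := by
    have := Int.le_ceil (D * Real.exp M)
    linarith
  have h4 : |f j| ≤ ⌈D * Real.exp M⌉ := by exact_mod_cast h3
  exact Finset.mem_Icc.2 (abs_le.1 h4)

theorem exists_int_round {δ : ℝ} (hδ : 0 < δ) (x : ℝ) :
    ∃ a : ℤ, |x - δ * a| ≤ δ ∧ |x - δ * a| ≤ |x| ∧ δ * |(a : ℝ)| ≤ |x| := by
  wlog hx : 0 ≤ x generalizing x
  · obtain ⟨a, h1, h2, h3⟩ := this (-x) (by linarith)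
    refine ⟨-a, ?_, ?_, ?_⟩
    · rw [← abs_neg]; convert h1 using 2; push_cast; ring
    · rw [← abs_neg, ← abs_neg x]; convert h2 using 2; push_cast; ring
    · rw [← abs_neg x]; simpa using h3
  have h1 := Int.floor_le (x / δ)
  have h2 := Int.lt_floor_add_one (x / δ)
  have h0 : 0 ≤ ⌊x / δ⌋ := Int.floor_nonneg.2 (by positivity)
  have h0' : (0 : ℝ) ≤ ⌊x / δ⌋ := by exact_mod_cast h0
  rw [le_div_iff₀ hδ] at h1
  rw [div_lt_iff₀ hδ] at h2
  have h3 : 0 ≤ δ * (⌊x / δ⌋ : ℝ) := by positivity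
  refine ⟨⌊x / δ⌋, ?_, ?_, ?_⟩
  · rw [abs_of_nonneg (by linarith)]; linarith
  · rw [abs_of_nonneg (by linarith), abs_of_nonneg hx]; linarith
  · rw [abs_of_nonneg h0', abs_of_nonneg hx]; linarith

theorem entropyNumber_le {n k : ℕ} {NX NY : (Fin n → ℝ) → ℝ} {ε : ℝ} (hε : 0 < ε)
    (T : Finset (Fin n → ℝ)) (hT : T.card ≤ 2 ^ (k - 1))
    (h : ∀ x, NX x ≤ 1 → ∃ y ∈ T, NY (x - y) ≤ ε) : entropyNumber n NX NY k ≤ ε :=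
  csInf_le ⟨0, fun _ hs => hs.1.le⟩ ⟨hε, T, hT, h⟩

theorem entropyNumber_antitone {n k k' : ℕ} {NX NY : (Fin n → ℝ) → ℝ} (hk : k ≤ k') {B : ℝ}
    (hB : 0 < B) (h : ∀ x, NX x ≤ 1 → NY x ≤ B) :
    entropyNumber n NX NY k' ≤ entropyNumber n NX NY k := by
  refine csInf_le_csInf ⟨0, fun _ hs => hs.1.le⟩
    ⟨B, hB, {0}, by simpa using Nat.one_le_two_pow, fun x hx => ⟨0, by simp, by simpa using h x hx⟩⟩
    ?_
  rintro ε ⟨hε, T, hT, hc⟩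
  exact ⟨hε, T, hT.trans (Nat.pow_le_pow_right (by norm_num) (by omega)), hc⟩

/-- Upper estimate of an entropy number by rounding to the grid `δ * ℤ ^ n`. -/
theorem entropyNumber_le_of_round {n k : ℕ} {NX NY : (Fin n → ℝ) → ℝ} {δ ε : ℝ} (hδ : 0 < δ)
    (hε : 0 < ε) (S : Finset (Fin n → ℤ)) (hS : S.card ≤ 2 ^ (k - 1))
    (hmem : ∀ x, NX x ≤ 1 → ∀ a : Fin n → ℤ, (∀ j, δ * |(a j : ℝ)| ≤ |x j|) → a ∈ S)
    (hNY : ∀ x r, NX x ≤ 1 → (∀ j, |r j| ≤ δ) → (∀ j, |r j| ≤ |x j|) → NY r ≤ ε) :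
    entropyNumber n NX NY k ≤ ε := by
  refine entropyNumber_le hε (S.image fun a j => δ * (a j : ℝ))
    (Finset.card_image_le.trans hS) fun x hx => ?_
  choose a h1 h2 h3 using fun j => exists_int_round hδ (x j)
  exact ⟨_, Finset.mem_image_of_mem _ (hmem x hx a h3), hNY x _ hx h1 h2⟩

/-- Lower estimate of an entropy number by counting the points of a finite family lying in a
common ball. -/
theorem le_entropyNumber {n k : ℕ} {NX NY : (Fin n → ℝ) → ℝ} {ι : Type*} {ε B N : ℝ}
    (hB : 0 < B) (hbd : ∀ x, NX x ≤ 1 → NY x ≤ B) (P : Finset ι) (φ : ι → Fin n → ℝ)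
    (hX : ∀ i ∈ P, NX (φ i) ≤ 1)
    (hN : ∀ (y : Fin n → ℝ) (S : Finset ι), S ⊆ P → (∀ i ∈ S, NY (φ i - y) ≤ ε) → S.card ≤ N)
    (hcard : 2 ^ (k - 1) * N < P.card) : ε ≤ entropyNumber n NX NY k := by
  refine le_csInf ⟨B, hB, {0}, by simpa using Nat.one_le_two_pow,
    fun x hx => ⟨0, by simp, by simpa using hbd x hx⟩⟩ ?_
  rintro η ⟨hη, T, hT, hc⟩
  by_contra! hlt
  have hN0 : 0 ≤ N := by simpa using hN 0 ∅ (Finset.empty_subset _) (by simp)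
  have hsub : P ⊆ T.biUnion fun y => P.filter fun i => NY (φ i - y) ≤ η := by
    intro i hi
    obtain ⟨y, hy, hyi⟩ := hc _ (hX i hi)
    exact Finset.mem_biUnion.2 ⟨y, hy, Finset.mem_filter.2 ⟨hi, hyi⟩⟩
  have h1 : (P.card : ℝ) ≤ ∑ y ∈ T, ((P.filter fun i => NY (φ i - y) ≤ η).card : ℝ) := by
    exact_mod_cast (Finset.card_le_card hsub).trans Finset.card_biUnion_le
  have h2 : ∑ y ∈ T, ((P.filter fun i => NY (φ i - y) ≤ η).card : ℝ) ≤ ∑ y ∈ T, N :=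
    Finset.sum_le_sum fun y _ => hN y _ (Finset.filter_subset _ _) fun i hi =>
      (Finset.mem_filter.1 hi).2.trans hlt.le
  rw [Finset.sum_const, nsmul_eq_mul] at h2
  have h3 : (T.card : ℝ) * N ≤ 2 ^ (k - 1) * N := by
    gcongr
    exact_mod_cast hT
  linarith

theorem le_two_pow_pred_of_le_exp {k c : ℕ} (hk : 1 ≤ k)
    (h : (c : ℝ) ≤ Real.exp (k * Real.log 2 / 2)) : c ≤ 2 ^ (k - 1) := by
  have h1 : (c : ℝ) ^ 2 ≤ 2 ^ k := by
    calc (c : ℝ) ^ 2 ≤ Real.exp (k * Real.log 2 / 2) ^ 2 := by gcongr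
      _ = 2 ^ k := by
        rw [← Real.exp_nat_mul]
        rw [show ((2 : ℕ) : ℝ) * (k * Real.log 2 / 2) = k * Real.log 2 by push_cast; ring,
          Real.exp_nat_mul, Real.exp_log (by norm_num)]
  have h2 : c ^ 2 ≤ 2 ^ k := by exact_mod_cast h1
  rcases Nat.lt_or_ge k 2 with h | h
  · have : k = 1 := by omega
    subst this
    simp only [pow_one, Nat.sub_self, pow_zero] at h2 ⊢
    nlinarith
  · have h3 : c ^ 2 ≤ (2 ^ (k - 1)) ^ 2 := by
      rw [← pow_mul]
      exact h2.trans (Nat.pow_le_pow_right (by norm_num) (by omega))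
    exact (Nat.pow_le_pow_iff_left (by norm_num)).1 h3

theorem exists_sum_log_rpow_le {α : ℝ} (hα : 0 < α) :
    ∃ C : ℝ, 1 ≤ C ∧ ∀ (m : ℕ) (L : ℝ), (m : ℝ) ≤ L →
      ∑ i ∈ Finset.Icc 1 m, Real.log (1 + (L / i) ^ α) ≤ C * L := by
  set V := 1 / (2 * α) with hVd
  have hV : 0 < V := by positivity
  have hαV : α * V = 1 / 2 := by rw [hVd]; field_simp
  refine ⟨max 1 (2 * (2 ^ V / V)), le_max_left _ _, fun m L hL => ?_⟩
  have hL0 : 0 ≤ L := (Nat.cast_nonneg m).trans hL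
  calc ∑ i ∈ Finset.Icc 1 m, Real.log (1 + (L / i) ^ α)
      ≤ ∑ i ∈ Finset.Icc 1 m, 2 ^ V / V * L ^ (1 / 2 : ℝ) * (i : ℝ) ^ ((1 / 2 : ℝ) - 1) := by
        refine Finset.sum_le_sum fun i hi => ?_
        have hi' := Finset.mem_Icc.1 hi
        have hi0 : (0 : ℝ) < i := by exact_mod_cast hi'.1
        have him : (i : ℝ) ≤ m := by exact_mod_cast hi'.2
        have h1 : 1 ≤ L / i := (one_le_div hi0).2 (by linarith)
        refine (log_one_add_le_rpow hV (Real.one_le_rpow h1 hα.le)).trans_eq ?_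
        rw [← Real.rpow_mul (by positivity), hαV, Real.div_rpow hL0 hi0.le,
          show (1 / 2 : ℝ) - 1 = -(1 / 2) by norm_num, Real.rpow_neg hi0.le]
        ring
    _ = 2 ^ V / V * L ^ (1 / 2 : ℝ) * ∑ i ∈ Finset.Icc 1 m, (i : ℝ) ^ ((1 / 2 : ℝ) - 1) := by
        rw [Finset.mul_sum]
    _ ≤ 2 ^ V / V * L ^ (1 / 2 : ℝ) * (2 * L ^ (1 / 2 : ℝ)) := by
        gcongr
        refine (sum_rpow_le (by norm_num) m).trans ?_
        rw [show max (1 : ℝ) (1 / (1 / 2)) = 2 by norm_num]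
        gcongr
    _ = 2 * (2 ^ V / V) * L := by
        rw [show 2 ^ V / V * L ^ (1 / 2 : ℝ) * (2 * L ^ (1 / 2 : ℝ)) =
          2 * (2 ^ V / V) * (L ^ (1 / 2 : ℝ) * L ^ (1 / 2 : ℝ)) by ring,
          ← Real.rpow_add_of_nonneg hL0 (by norm_num) (by norm_num)]
        norm_num
    _ ≤ _ := by gcongr; exact le_max_right _ _

theorem toReal_one_div_pos {p : ℝ≥0∞} (hp : 0 < p) (hp' : p ≠ ⊤) : 0 < (1 / p).toReal := by
  have := ENNReal.toReal_pos hp.ne' hp'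
  simp only [one_div, ENNReal.toReal_inv]
  positivity

theorem exists_lorentzNorm_top_bound {p u v : ℝ≥0∞} (hp : 0 < p) (hp' : p ≠ ⊤) (hu : 0 < u)
    (hv : 0 < v) : ∃ B : ℝ, 0 < B ∧ ∀ (n : ℕ) (x : Fin n → ℝ), lorentzNorm n p u x ≤ 1 →
      lorentzNorm n ⊤ v x ≤ B := by
  obtain ⟨K, hK, hKr⟩ := exists_rearr_le hp hp' hu
  have hα := toReal_one_div_pos hp hp'
  obtain ⟨C, hC, hE⟩ := exists_lorentzNorm_top_le hα hv
  have : 0 < Real.log (1 + 1) := Real.log_pos (by norm_num)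
  refine ⟨C * K * ((1 : ℝ) ^ (-(1 / p).toReal) * Real.log (1 + 1) ^ (1 / v).toReal),
    by positivity, fun n x hx => hE n 1 K x le_rfl hK.le (fun i hi => ?_) (hKr n x hx)⟩
  refine (hKr n x hx i hi).trans ?_
  have hi1 : (1 : ℝ) ≤ i := by exact_mod_cast (Finset.mem_Icc.1 hi).1
  gcongr ?_ * ?_
  exact Real.rpow_le_rpow_of_nonpos one_pos hi1 (by linarith)

theorem exists_entropyNumber_le_mid {p u v : ℝ≥0∞} (hp : 0 < p) (hp' : p ≠ ⊤) (hu : 0 < u)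
    (hv : 0 < v) : ∃ C : ℝ, 0 < C ∧ ∀ n k : ℕ, 1 ≤ k → Real.log ((n : ℝ) + 1) ≤ k → k ≤ n →
      entropyNumber n (lorentzNorm n p u) (lorentzNorm n ⊤ v) k ≤
        C * (((k : ℝ) / Real.log ((n : ℝ) / (k : ℝ) + 1)) ^ (-(1 / p).toReal) *
          Real.log ((k : ℝ) / Real.log ((n : ℝ) / (k : ℝ) + 1) + 1) ^ (1 / v).toReal) := by
  obtain ⟨K, hK, hKr⟩ := exists_rearr_le hp hp' hu
  have hα := toReal_one_div_pos hp hp'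
  set α := (1 / p).toReal
  obtain ⟨C, hC, hE⟩ := exists_lorentzNorm_top_le hα hv
  obtain ⟨C₁, hC₁, hQ⟩ := exists_sum_log_rpow_le hα
  set c₂ : ℝ := 1 / (100 * C₁) with hc₂
  have hc₂p : 0 < c₂ := by positivity
  have hc₂1 : c₂ ≤ 1 := by rw [hc₂, div_le_one (by positivity)]; linarith
  refine ⟨C * (K * c₂ ^ (-α)), by positivity, fun n k hk hlog hkn => ?_⟩
  have hk1 : (1 : ℝ) ≤ k := by exact_mod_cast hk
  have hkn' : (k : ℝ) ≤ n := by exact_mod_cast hkn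
  set t : ℝ := (n : ℝ) / k with ht
  have ht1 : 1 ≤ t := (one_le_div (by linarith)).2 hkn'
  have hl2 : 0.69 < Real.log 2 := by linarith [Real.log_two_gt_d9]
  have hlt2 : Real.log 2 ≤ Real.log (t + 1) := Real.log_le_log (by norm_num) (by linarith)
  have hltp : 0 < Real.log (t + 1) := by linarith
  set l : ℝ := (k : ℝ) / Real.log (t + 1) with hl
  have hl1 : 1 ≤ l := by
    rw [hl, one_le_div hltp]
    refine le_trans (Real.log_le_log (by linarith) ?_) hlog
    have : t ≤ n := div_le_self (by linarith) hk1
    linarith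
  have hlp : 0 < Real.log (l + 1) := Real.log_pos (by linarith)
  set L : ℝ := c₂ * l with hL
  have hLp : 0 < L := by positivity
  set δ : ℝ := K * L ^ (-α) with hδ
  have hδp : 0 < δ := by positivity
  have hδ' : δ = K * c₂ ^ (-α) * l ^ (-α) := by
    rw [hδ, hL, Real.mul_rpow hc₂p.le (by linarith)]; ring
  have hfin := finite_log_weight_le (n := n) one_pos (C₁ * L)
  refine entropyNumber_le_of_round hδp (by positivity) hfin.toFinset ?_ ?_ ?_
  · set q := (Real.log (t + 1) + 5) / Real.log 2 with hq
    have hql : q * Real.log 2 = Real.log (t + 1) + 5 := by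
      rw [hq]; field_simp
    have hq2 : 2 ≤ q := by
      rw [hq, le_div_iff₀ (by linarith)]; linarith [Real.log_two_lt_d9]
    refine le_two_pow_pred_of_le_exp hk ((card_le_of_log_weight_sparse hq2 _ (M := C₁ * L)
      fun f hf => by simpa using hf).trans (Real.exp_le_exp.2 ?_))
    have e5 : Real.exp (-(q * Real.log 2)) * n ≤ k / 140 := by
      rw [hql, neg_add, Real.exp_add, Real.exp_neg, Real.exp_log (by linarith)]
      have h5 : Real.exp (-5) ≤ 1 / 140 := by
        rw [Real.exp_neg, ← one_div]
        refine one_div_le_one_div_of_le (by norm_num) ?_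
        have h1 : (2.7 : ℝ) ^ 5 ≤ Real.exp 1 ^ 5 := by
          gcongr; linarith [Real.exp_one_gt_d9]
        rw [← Real.exp_nat_mul] at h1
        norm_num at h1
        linarith
      have h6 : (t + 1)⁻¹ * n ≤ k := by
        rw [inv_mul_le_iff₀ (by linarith)]
        have : t * k = n := by rw [ht]; field_simp
        nlinarith
      calc (t + 1)⁻¹ * Real.exp (-5) * n = ((t + 1)⁻¹ * n) * Real.exp (-5) := by ring
        _ ≤ k * (1 / 140) := by gcongr
        _ = _ := by ring
    have e6 : q * (C₁ * L) ≤ 0.12 * k := by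
      have : q * (C₁ * L) = (k / 100 / Real.log 2) * (1 + 5 / Real.log (t + 1)) := by
        rw [hL, hq, hl, hc₂]; field_simp
      rw [this]
      have h7 : 5 / Real.log (t + 1) ≤ 7.25 := by
        rw [div_le_iff₀ hltp]; nlinarith
      have h8 : (k : ℝ) / 100 / Real.log 2 ≤ k / 69 := by
        rw [div_div]
        gcongr
        linarith
      calc _ ≤ (k : ℝ) / 69 * (1 + 7.25) := by gcongr
        _ ≤ _ := by nlinarith
    nlinarith
  · intro x hx a ha
    rw [Set.Finite.mem_toFinset, Set.mem_ofPred_eq]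
    have hr := hKr n x hx
    set F : ℝ → ℝ := fun s => if s < δ then 0 else Real.log (1 + s / δ) with hF
    calc ∑ j, Real.log (1 + |(a j : ℝ)| / 1) ≤ ∑ j, F |x j| := by
          refine Finset.sum_le_sum fun j _ => ?_
          have h1 := ha j
          rw [hF, div_one]
          simp only
          split_ifs with h
          · have : a j = 0 := by
              by_contra h0
              have h2 : (1 : ℝ) ≤ |(a j : ℝ)| := by exact_mod_cast Int.one_le_abs h0
              nlinarith
            simp [this]
          · have : |(a j : ℝ)| ≤ |x j| / δ := by rw [le_div_iff₀ hδp]; linarith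
            exact Real.log_le_log (by positivity) (by linarith)
      _ = ∑ i ∈ Finset.Icc 1 n, F (rearr n x i) := (sum_comp_rearr n x F).symm
      _ ≤ ∑ i ∈ (Finset.Icc 1 n).filter (fun i : ℕ => (i : ℝ) ≤ L),
            Real.log (1 + (L / i) ^ α) := by
          rw [Finset.sum_filter]
          refine Finset.sum_le_sum fun i hi => ?_
          have hi0 : (0 : ℝ) < i := by exact_mod_cast (Finset.mem_Icc.1 hi).1
          have hri := hr i hi
          have h0 := rearr_nonneg n x i
          rw [hF]
          simp only
          by_cases hiL : (i : ℝ) ≤ L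
          · rw [if_pos hiL]
            have h3 : rearr n x i / δ ≤ (L / i) ^ α := by
              rw [div_le_iff₀ hδp]
              refine hri.trans_eq ?_
              rw [hδ, Real.div_rpow hLp.le hi0.le, Real.rpow_neg hLp.le, Real.rpow_neg hi0.le]
              field_simp
            have h4 : 0 ≤ rearr n x i / δ := by positivity
            have h5 : Real.log (1 + rearr n x i / δ) ≤ Real.log (1 + (L / i) ^ α) :=
              Real.log_le_log (by linarith) (by linarith)
            split_ifs
            · exact Real.log_nonneg (by linarith)
            · exact h5
          · rw [if_neg hiL, if_pos]
            refine hri.trans_lt ?_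
            rw [hδ]
            gcongr ?_ * ?_
            exact Real.rpow_lt_rpow_of_neg hLp (not_le.1 hiL) (by linarith)
      _ ≤ ∑ i ∈ Finset.Icc 1 ⌊L⌋₊, Real.log (1 + (L / i) ^ α) := by
          refine Finset.sum_le_sum_of_subset_of_nonneg ?_ fun i _ _ =>
            Real.log_nonneg (by have : 0 ≤ (L / i) ^ α := by positivity
                                linarith)
          intro i hi
          simp only [Finset.mem_filter, Finset.mem_Icc] at hi ⊢
          exact ⟨hi.1.1, Nat.le_floor hi.2⟩
      _ ≤ C₁ * L := hQ _ L (Nat.floor_le hLp.le)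
  · intro x r hx h1 h2
    refine hE n l (K * c₂ ^ (-α)) r hl1 (by positivity) (fun i _ => ?_) fun i hi => ?_
    · rw [← hδ']; exact rearr_le_of_abs_le hδp.le h1 i
    · refine (rearr_mono h2 i).trans ((hKr n x hx i hi).trans ?_)
      gcongr
      have := Real.one_le_rpow_of_pos_of_le_one_of_nonpos hc₂p hc₂1 (by linarith : -α ≤ 0)
      nlinarith

theorem exists_entropyNumber_le_large {p u v : ℝ≥0∞} (hp : 0 < p) (hp' : p ≠ ⊤) (hu : 0 < u)
    (hv : 0 < v) : ∃ C : ℝ, 0 < C ∧ ∀ n k : ℕ, 0 < n → n ≤ k →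
      entropyNumber n (lorentzNorm n p u) (lorentzNorm n ⊤ v) k ≤
        C * ((2 : ℝ) ^ (-(k : ℝ) / (n : ℝ)) * (n : ℝ) ^ (-(1 / p).toReal) *
          Real.log ((n : ℝ) + 1) ^ (1 / v).toReal) := by
  obtain ⟨K, hK, hKr⟩ := exists_rearr_le hp hp' hu
  have hα := toReal_one_div_pos hp hp'
  obtain ⟨Cm, hCm, hmid⟩ := exists_entropyNumber_le_mid hp hp' hu hv
  obtain ⟨B, hB, hbd⟩ := exists_lorentzNorm_top_bound hp hp' hu hv
  set α := (1 / p).toReal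
  have hβ : 0 ≤ (1 / v).toReal := ENNReal.toReal_nonneg
  set β := (1 / v).toReal
  obtain ⟨C, hC, hE⟩ := exists_lorentzNorm_top_le hα hv
  obtain ⟨C₁, hC₁, hQ⟩ := exists_sum_log_rpow_le hα
  set E : ℝ := Real.exp (2 * C₁) with hEd
  have hEp : 0 < E := Real.exp_pos _
  refine ⟨C * (K * (8 * E)) + Cm * 2 ^ β * (4 * E), by positivity, fun n k hn hnk => ?_⟩
  have hn1 : (1 : ℝ) ≤ n := by exact_mod_cast hn
  have hn0 : (0 : ℝ) < n := by linarith
  have hlp : 0 < Real.log ((n : ℝ) + 1) := Real.log_pos (by linarith)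
  set g : ℝ := (2 : ℝ) ^ ((k : ℝ) / n) with hg
  have hgp : 0 < g := by positivity
  have hgn : g ^ n = 2 ^ k := by
    rw [hg, ← Real.rpow_natCast, ← Real.rpow_mul (by norm_num), div_mul_cancel₀ _ hn0.ne',
      Real.rpow_natCast]
  rw [show (2 : ℝ) ^ (-(k : ℝ) / (n : ℝ)) = g⁻¹ by rw [neg_div, Real.rpow_neg (by norm_num)]]
  rcases lt_or_ge g (4 * E) with hsm | hbig
  · refine (entropyNumber_antitone hnk hB (hbd n)).trans ((hmid n n hn ?_ le_rfl).trans ?_)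
    · linarith [Real.log_le_sub_one_of_pos (show (0 : ℝ) < n + 1 by linarith)]
    · rw [div_self hn0.ne', show (1 : ℝ) + 1 = 2 by norm_num]
      have hl2 : 0.69 < Real.log 2 := by linarith [Real.log_two_gt_d9]
      have hl2' : Real.log 2 < 0.7 := by linarith [Real.log_two_lt_d9]
      have h1 : (n : ℝ) ≤ n / Real.log 2 := by
        rw [le_div_iff₀ (by linarith)]; nlinarith
      have h2 : (n : ℝ) / Real.log 2 ≤ 2 * n := by
        rw [div_le_iff₀ (by linarith)]; nlinarith
      have h3 : Real.log (n / Real.log 2 + 1) ≤ 2 * Real.log ((n : ℝ) + 1) := by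
        rw [← Nat.cast_ofNat, ← Real.log_pow]
        refine Real.log_le_log (by linarith) ?_
        nlinarith
      have h4 : 0 ≤ Real.log (n / Real.log 2 + 1) := Real.log_nonneg (by linarith)
      have h5 : 1 ≤ 4 * E * g⁻¹ := by
        rw [← div_eq_mul_inv, one_le_div hgp]; exact hsm.le
      calc Cm * ((n / Real.log 2) ^ (-α) * Real.log (n / Real.log 2 + 1) ^ β)
          ≤ Cm * ((n : ℝ) ^ (-α) * (2 * Real.log ((n : ℝ) + 1)) ^ β) := by
            gcongr Cm * (?_ * ?_)
            · exact Real.rpow_le_rpow_of_nonpos hn0 h1 (by linarith)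
            · exact Real.rpow_le_rpow h4 h3 hβ
        _ = Cm * 2 ^ β * ((n : ℝ) ^ (-α) * Real.log ((n : ℝ) + 1) ^ β) * 1 := by
            rw [Real.mul_rpow (by norm_num) hlp.le]; ring
        _ ≤ Cm * 2 ^ β * ((n : ℝ) ^ (-α) * Real.log ((n : ℝ) + 1) ^ β) * (4 * E * g⁻¹) := by
            gcongr
        _ = Cm * 2 ^ β * (4 * E) * (g⁻¹ * (n : ℝ) ^ (-α) * Real.log ((n : ℝ) + 1) ^ β) := by ring
        _ ≤ _ := by gcongr; linarith [show 0 < C * (K * (8 * E)) by positivity]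
  · set D := g / (8 * E) with hD
    have hDp : 0 < D := by positivity
    set δ := K * (8 * E) * g⁻¹ * (n : ℝ) ^ (-α) with hδ
    have hδp : 0 < δ := by positivity
    have hDδ : D * δ = K * (n : ℝ) ^ (-α) := by rw [hD, hδ]; field_simp
    refine le_trans (b := C * (K * (8 * E) * g⁻¹) *
      ((n : ℝ) ^ (-α) * Real.log ((n : ℝ) + 1) ^ β)) ?_ ?_
    swap
    · calc _ = C * (K * (8 * E)) * (g⁻¹ * (n : ℝ) ^ (-α) * Real.log ((n : ℝ) + 1) ^ β) := by ring
        _ ≤ _ := by gcongr; linarith [show 0 < Cm * 2 ^ β * (4 * E) by positivity]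
    have hfin := finite_log_weight_le (n := n) hDp (C₁ * n)
    refine entropyNumber_le_of_round hδp (by positivity) hfin.toFinset ?_ ?_ ?_
    · have h1 := card_le_of_log_weight hDp 0 hfin.toFinset (M := C₁ * n)
        fun f hf => by simpa using hf
      have h2 : Real.exp (2 * (C₁ * n)) * (1 + 2 * D) ^ n = (E * (1 + 2 * D)) ^ n := by
        rw [mul_pow, hEd, ← Real.exp_nat_mul]; ring_nf
      have h3 : E * (1 + 2 * D) ≤ g / 2 := by
        have : E * (1 + 2 * D) = E + g / 4 := by rw [hD]; field_simp; ring
        linarith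
      have h4 : (hfin.toFinset.card : ℝ) ≤ 2 ^ k / 2 ^ n := by
        rw [h2] at h1
        refine h1.trans ((pow_le_pow_left₀ (by positivity) h3 n).trans_eq ?_)
        rw [div_pow, hgn]
      rw [le_div_iff₀ (by positivity)] at h4
      have h5 : hfin.toFinset.card * 2 ^ n ≤ 2 ^ k := by exact_mod_cast h4
      have h6 : 2 ^ 1 ≤ 2 ^ n := Nat.pow_le_pow_right (by norm_num) hn
      have h7 : 2 ^ k = 2 * 2 ^ (k - 1) := by
        rw [← pow_succ', Nat.sub_add_cancel (by omega)]
      nlinarith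
    · intro x hx a ha
      rw [Set.Finite.mem_toFinset, Set.mem_ofPred_eq]
      have hr := hKr n x hx
      calc ∑ j, Real.log (1 + |(a j : ℝ)| / D) ≤ ∑ j, Real.log (1 + |x j| / (D * δ)) := by
            refine Finset.sum_le_sum fun j _ => Real.log_le_log (by positivity) ?_
            gcongr 1 + ?_
            rw [div_le_div_iff₀ hDp (by positivity)]
            calc _ = D * (δ * |(a j : ℝ)|) := by ring
              _ ≤ D * |x j| := by gcongr; exact ha j
              _ = _ := by ring
        _ = ∑ i ∈ Finset.Icc 1 n, Real.log (1 + rearr n x i / (D * δ)) :=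
            (sum_comp_rearr n x fun s => Real.log (1 + s / (D * δ))).symm
        _ ≤ ∑ i ∈ Finset.Icc 1 n, Real.log (1 + ((n : ℝ) / i) ^ α) := by
            refine Finset.sum_le_sum fun i hi => ?_
            have hi0 : (0 : ℝ) < i := by exact_mod_cast (Finset.mem_Icc.1 hi).1
            have h0 := rearr_nonneg n x i
            refine Real.log_le_log (by positivity) ?_
            gcongr 1 + ?_
            rw [hDδ, div_le_iff₀ (by positivity)]
            refine (hr i hi).trans_eq ?_
            rw [Real.div_rpow hn0.le hi0.le, Real.rpow_neg hn0.le, Real.rpow_neg hi0.le]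
            field_simp
        _ ≤ C₁ * n := hQ n n le_rfl
    · intro x r hx h1 _
      refine hE n n (K * (8 * E) * g⁻¹) r hn1 (by positivity) (fun i _ => ?_) fun i hi => ?_
      · exact rearr_le_of_abs_le hδp.le h1 i
      · refine (rearr_le_of_abs_le hδp.le h1 i).trans ?_
        have hi0 : (0 : ℝ) < i := by exact_mod_cast (Finset.mem_Icc.1 hi).1
        have hin : (i : ℝ) ≤ n := by exact_mod_cast (Finset.mem_Icc.1 hi).2
        rw [hδ]
        gcongr ?_ * ?_
        exact Real.rpow_le_rpow_of_nonpos hi0 hin (by linarith)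

theorem log_one_add_abs_sub_le {a b y R : ℝ} (hR : 0 < R) :
    Real.log (1 + |a - b| / R) ≤
      Real.log (1 + |a - y| / R) + Real.log (1 + |b - y| / R) := by
  rw [← Real.log_mul (by positivity) (by positivity)]
  refine Real.log_le_log (by positivity) ?_
  have h1 : |a - b| / R ≤ |a - y| / R + |b - y| / R := by
    rw [← add_div, abs_sub_comm b y]
    gcongr
    exact abs_sub_le a y b
  have h2 : 0 ≤ |a - y| / R * (|b - y| / R) := by positivity
  nlinarith

theorem exists_le_entropyNumber_large {p u v : ℝ≥0∞} (hp : 0 < p) (hp' : p ≠ ⊤) (hu : 0 < u)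
    (hv : 0 < v) : ∃ c : ℝ, 0 < c ∧ ∀ n k : ℕ, 0 < n → n ≤ k →
      c * ((2 : ℝ) ^ (-(k : ℝ) / (n : ℝ)) * (n : ℝ) ^ (-(1 / p).toReal) *
        Real.log ((n : ℝ) + 1) ^ (1 / v).toReal) ≤
      entropyNumber n (lorentzNorm n p u) (lorentzNorm n ⊤ v) k := by
  obtain ⟨K, hK, hKn⟩ := exists_lorentzNorm_le hp hp' hu
  obtain ⟨C, hC, hCs⟩ := exists_sum_log_le hv
  obtain ⟨B, hB, hbd⟩ := exists_lorentzNorm_top_bound hp hp' hu hv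
  set α := (1 / p).toReal
  set E : ℝ := Real.exp (4 * C) with hE
  have hE0 : 0 < E := Real.exp_pos _
  refine ⟨1 / (4 * E * K), by positivity, fun n k hn hnk => ?_⟩
  have hn0 : (0 : ℝ) < n := by exact_mod_cast hn
  set g : ℝ := (2 : ℝ) ^ ((k : ℝ) / n) with hg
  have hg0 : 0 < g := by positivity
  have hgn : g ^ n = 2 ^ k := by
    rw [hg, ← Real.rpow_natCast, ← Real.rpow_mul (by norm_num), div_mul_cancel₀ _ hn0.ne',
      Real.rpow_natCast]
  set b : ℕ := ⌈2 * g * E⌉₊ with hb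
  have hbg : 2 * g * E ≤ b := Nat.le_ceil _
  have hb0 : (0 : ℝ) < b := lt_of_lt_of_le (by positivity) hbg
  set τ : ℝ := (n : ℝ) ^ (-α) / (K * b) with hτ
  have hτ0 : 0 < τ := by positivity
  set D : ℝ := b / (4 * g * E) with hD
  have hD0 : 0 < D := by positivity
  have hR : 0 < D * τ := by positivity
  have hDτ : D * τ = 1 / (4 * E * K) * ((2 : ℝ) ^ (-(k : ℝ) / n) * (n : ℝ) ^ (-α)) := by
    rw [neg_div, Real.rpow_neg (by norm_num), hD, hτ, ← hg]
    field_simp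
  rw [← mul_assoc, ← hDτ]
  refine le_entropyNumber (N := (E * (1 + 2 * D)) ^ n) hB (hbd n)
    (Fintype.piFinset fun _ => Finset.Ico (0 : ℤ) b) (fun f j => τ * (f j : ℝ)) ?_ ?_ ?_
  · intro f hf
    have h := hKn n n (fun j => τ * (f j : ℝ)) ((n : ℝ) ^ (-α) / K) (by positivity) ?_ ?_
    · refine h.trans (le_of_eq ?_)
      rw [Real.rpow_neg hn0.le]
      field_simp
    · intro j
      have hj := Finset.mem_Ico.1 (Fintype.mem_piFinset.1 hf j)
      have h0 : (0 : ℝ) ≤ f j := by exact_mod_cast hj.1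
      have h1 : (f j : ℝ) ≤ b := by exact_mod_cast hj.2.le
      rw [abs_of_nonneg (by positivity)]
      calc τ * f j ≤ τ * b := by gcongr
        _ = _ := by rw [hτ]; field_simp
    · exact (Finset.card_le_univ _).trans (by simp)
  · intro y S _ hSy
    rcases S.eq_empty_or_nonempty with rfl | ⟨f₀, hf₀⟩
    · simp only [Finset.card_empty, Nat.cast_zero]; positivity
    have h := card_le_of_log_weight (M := 2 * C * n) hD0 f₀ S ?_
    · refine h.trans (le_of_eq ?_)
      rw [mul_pow, hE, ← Real.exp_nat_mul]
      congr 2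
      ring
    · intro f hf
      have e1 := hCs n _ _ hn hR (hSy f hf)
      have e2 := hCs n _ _ hn hR (hSy f₀ hf₀)
      have e3 : ∑ j, Real.log (1 + |(f j : ℝ) - f₀ j| / D) ≤
          ∑ j, (Real.log (1 + |τ * (f j : ℝ) - y j| / (D * τ)) +
            Real.log (1 + |τ * (f₀ j : ℝ) - y j| / (D * τ))) := by
        refine Finset.sum_le_sum fun j _ => ?_
        refine le_trans (le_of_eq ?_) (log_one_add_abs_sub_le hR)
        rw [← mul_sub, abs_mul, abs_of_pos hτ0, mul_comm τ, mul_div_mul_right _ _ hτ0.ne']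
      rw [Finset.sum_add_distrib] at e3
      simp only [Pi.sub_apply] at e1 e2
      linarith
  · rw [Fintype.card_piFinset]
    simp only [Int.card_Ico, sub_zero, Int.toNat_natCast, Finset.prod_const, Finset.card_univ,
      Fintype.card_fin, Nat.cast_pow]
    have hk : 1 ≤ k := by omega
    have h1 : (2 : ℝ) ^ (k - 1) < g ^ n := by
      rw [hgn]; exact pow_lt_pow_right₀ (by norm_num) (by omega)
    calc (2 : ℝ) ^ (k - 1) * (E * (1 + 2 * D)) ^ n < g ^ n * (E * (1 + 2 * D)) ^ n := by gcongr
      _ = (g * E * (1 + 2 * D)) ^ n := by rw [← mul_pow]; ring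
      _ ≤ (b : ℝ) ^ n := by
        gcongr
        have : g * E * (1 + 2 * D) = g * E + b / 2 := by rw [hD]; field_simp; ring
        rw [this]; linarith

theorem card_le_of_hamming {m b d : ℕ} {q : ℝ} (hq : 1 ≤ q) (f₀ : Fin m → Fin b)
    (S : Finset (Fin m → Fin b))
    (hS : ∀ f ∈ S, (Finset.univ.filter fun i => f i ≠ f₀ i).card ≤ d) :
    (S.card : ℝ) ≤ q ^ d * (1 + b / q) ^ m := by
  have hq0 : 0 < q := by linarith
  have h := card_le_exp_mul_prod S (fun i a => if a = f₀ i then 0 else Real.log q)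
    (d * Real.log q) (1 + b / q) ?_ ?_
  · rwa [Real.exp_nat_mul, Real.exp_log hq0, Fintype.card_fin] at h
  · intro f hf
    have e : ∑ i, (if f i = f₀ i then 0 else Real.log q) =
        (Finset.univ.filter fun i => f i ≠ f₀ i).card * Real.log q := by
      rw [← nsmul_eq_mul, ← Finset.sum_const, Finset.sum_filter]
      exact Finset.sum_congr rfl fun i _ => by by_cases h : f i = f₀ i <;> simp [h]
    rw [e]
    have := hS f hf
    have := Real.log_nonneg hq
    gcongr
  · intro i A
    calc ∑ a ∈ A, Real.exp (-(if a = f₀ i then 0 else Real.log q))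
        ≤ ∑ a : Fin b, Real.exp (-(if a = f₀ i then 0 else Real.log q)) :=
          Finset.sum_le_univ_sum_of_nonneg fun a => (Real.exp_pos _).le
      _ ≤ ∑ a : Fin b, ((if a = f₀ i then 1 else 0) + 1 / q) := by
          refine Finset.sum_le_sum fun a _ => ?_
          split_ifs
          · simp; positivity
          · simp [Real.exp_neg, Real.exp_log hq0]
      _ = 1 + b / q := by
          rw [Finset.sum_add_distrib]
          simp [div_eq_mul_inv]

theorem log_le_three_mul_log {m N : ℕ} (h : m < 4 * N) :
    Real.log ((m : ℝ) + 1) ≤ 3 * Real.log ((N : ℝ) + 1) := by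
  have h1 : (m : ℝ) + 1 ≤ 4 * N := by exact_mod_cast h
  have h2 : (0 : ℝ) ≤ N := N.cast_nonneg
  have h3 : 3 * Real.log ((N : ℝ) + 1) = Real.log (((N : ℝ) + 1) ^ 3) := by
    rw [Real.log_pow]; norm_num
  rw [h3]
  refine Real.log_le_log (by positivity) ?_
  nlinarith [mul_nonneg h2 (sq_nonneg ((N : ℝ) - 1)), mul_nonneg h2 h2, sq_nonneg ((N : ℝ) - 1)]

theorem card_large_le_of_lorentzNorm_top_le {v : ℝ≥0∞} (hv : 0 < v) {n m : ℕ} {τ : ℝ}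
    (hτ : 0 < τ) (z : Fin n → ℝ)
    (hz : lorentzNorm n ⊤ v z ≤
      τ / 4 * ((1 / 3) * Real.log ((m : ℝ) + 1)) ^ (1 / v).toReal) :
    4 * (Finset.univ.filter fun j => τ / 2 ≤ |z j|).card ≤ m := by
  by_contra! hlt
  set N := (Finset.univ.filter fun j => τ / 2 ≤ |z j|).card with hN
  have hN1 : 1 ≤ N := by omega
  have h1 := mul_log_card_le_lorentzNorm_top hv z (half_pos hτ) hN1 hN
  have hN1' : (1 : ℝ) ≤ N := by exact_mod_cast hN1
  have h2 : 0 < Real.log ((N : ℝ) + 1) := Real.log_pos (by linarith)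
  have h3 := log_le_three_mul_log hlt
  have h4 : 0 ≤ Real.log ((m : ℝ) + 1) :=
    Real.log_nonneg (by linarith [(m.cast_nonneg : (0 : ℝ) ≤ m)])
  have h5 : ((1 / 3) * Real.log ((m : ℝ) + 1)) ^ (1 / v).toReal ≤
      Real.log ((N : ℝ) + 1) ^ (1 / v).toReal :=
    Real.rpow_le_rpow (by positivity) (by linarith) ENNReal.toReal_nonneg
  have h6 : 0 < Real.log ((N : ℝ) + 1) ^ (1 / v).toReal := by positivity
  nlinarith

/-- Lower estimate of the entropy numbers by a code of vectors with exactly one nonzero entry in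
each of `m` blocks of length `b`. -/
theorem exists_le_entropyNumber_of_blocks {p u v : ℝ≥0∞} (hp : 0 < p) (hp' : p ≠ ⊤) (hu : 0 < u)
    (hv : 0 < v) : ∃ c : ℝ, 0 < c ∧ ∀ (n m b k : ℕ) (q : ℝ), 1 ≤ m → m * b ≤ n → 1 ≤ q →
      (2 : ℝ) ^ (k - 1) * (q ^ (m / 2) * (1 + b / q) ^ m) < (b : ℝ) ^ m →
      c * ((m : ℝ) ^ (-(1 / p).toReal) * Real.log ((m : ℝ) + 1) ^ (1 / v).toReal) ≤
        entropyNumber n (lorentzNorm n p u) (lorentzNorm n ⊤ v) k := by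
  obtain ⟨K, hK, hKn⟩ := exists_lorentzNorm_le hp hp' hu
  obtain ⟨B, hB, hbd⟩ := exists_lorentzNorm_top_bound hp hp' hu hv
  set α := (1 / p).toReal
  refine ⟨1 / (4 * K) * (1 / 3) ^ (1 / v).toReal, by positivity,
    fun n m b k q hm hmb hq hcard => ?_⟩
  have hm0 : (0 : ℝ) < m := by exact_mod_cast hm
  have hlog : 0 ≤ Real.log ((m : ℝ) + 1) := Real.log_nonneg (by linarith)
  set τ : ℝ := (m : ℝ) ^ (-α) / K with hτ
  have hτ0 : 0 < τ := by positivity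
  have hε : 1 / (4 * K) * (1 / 3) ^ (1 / v).toReal *
      ((m : ℝ) ^ (-α) * Real.log ((m : ℝ) + 1) ^ (1 / v).toReal) =
      τ / 4 * ((1 / 3) * Real.log ((m : ℝ) + 1)) ^ (1 / v).toReal := by
    rw [Real.mul_rpow (by norm_num) hlog, hτ]
    field_simp
  rw [hε]
  let e : Fin m × Fin b → Fin n := fun x => Fin.castLE hmb (finProdFinEquiv x)
  have he : Function.Injective e := (Fin.castLE_injective hmb).comp finProdFinEquiv.injective
  let φ : (Fin m → Fin b) → Fin n → ℝ := fun f j => if ∃ i, j = e (i, f i) then τ else 0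
  have hφ : ∀ f i, φ f (e (i, f i)) = τ := fun f i => if_pos ⟨i, rfl⟩
  have hφ' : ∀ f i a, a ≠ f i → φ f (e (i, a)) = 0 := by
    intro f i a ha
    refine if_neg ?_
    rintro ⟨i', h⟩
    have := he h
    simp only [Prod.mk.injEq] at this
    obtain ⟨rfl, h⟩ := this
    exact ha h
  refine le_entropyNumber (N := q ^ (m / 2) * (1 + b / q) ^ m) hB (hbd n) Finset.univ φ ?_ ?_ ?_
  · intro f _
    have h := hKn n m (φ f) τ hτ0.le ?_ ?_
    · refine h.trans (le_of_eq ?_)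
      rw [hτ, Real.rpow_neg hm0.le]
      field_simp
    · intro j
      simp only [φ]
      split_ifs
      · exact (abs_of_pos hτ0).le
      · simpa using hτ0.le
    · have hsub : (Finset.univ.filter fun j => φ f j ≠ 0) ⊆
          Finset.univ.image fun i => e (i, f i) := by
        intro j hj
        have hj := (Finset.mem_filter.1 hj).2
        by_cases h : ∃ i, j = e (i, f i)
        · obtain ⟨i, rfl⟩ := h
          exact Finset.mem_image_of_mem _ (Finset.mem_univ i)
        · exact absurd (if_neg h) hj
      exact (Finset.card_le_card hsub).trans (Finset.card_image_le.trans (by simp))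
  · intro y S _ hSy
    rcases S.eq_empty_or_nonempty with rfl | ⟨f₀, hf₀⟩
    · simp only [Finset.card_empty, Nat.cast_zero]; positivity
    refine card_le_of_hamming hq f₀ S fun f hf => ?_
    have n1 := card_large_le_of_lorentzNorm_top_le hv hτ0 _ (hSy f hf)
    have n2 := card_large_le_of_lorentzNorm_top_le hv hτ0 _ (hSy f₀ hf₀)
    have hinj : Function.Injective fun i => e (i, f i) := fun i i' h => by
      simpa using congrArg Prod.fst (he h)
    have hsub : (Finset.univ.filter fun i => f i ≠ f₀ i).image (fun i => e (i, f i)) ⊆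
        (Finset.univ.filter fun j => τ / 2 ≤ |(φ f - y) j|) ∪
          (Finset.univ.filter fun j => τ / 2 ≤ |(φ f₀ - y) j|) := by
      intro j hj
      obtain ⟨i, hi, rfl⟩ := Finset.mem_image.1 hj
      have hi := (Finset.mem_filter.1 hi).2
      simp only [Finset.mem_union, Finset.mem_filter, Finset.mem_univ, true_and, Pi.sub_apply,
        hφ, hφ' f₀ i _ hi, zero_sub, abs_neg]
      by_contra! h
      have h1 := (abs_lt.1 h.1).2
      have h2 := (abs_lt.1 h.2).2
      linarith
    have h3 := (Finset.card_le_card hsub).trans (Finset.card_union_le _ _)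
    rw [Finset.card_image_of_injective _ hinj] at h3
    omega
  · simpa using hcard

theorem exists_entropyNumber_le_const {p u v : ℝ≥0∞} (hp : 0 < p) (hp' : p ≠ ⊤) (hu : 0 < u)
    (hv : 0 < v) : ∃ C : ℝ, 0 < C ∧ ∀ n k : ℕ,
      entropyNumber n (lorentzNorm n p u) (lorentzNorm n ⊤ v) k ≤ C := by
  obtain ⟨B, hB, hbd⟩ := exists_lorentzNorm_top_bound hp hp' hu hv
  exact ⟨B, hB, fun n k => entropyNumber_le hB {0} (by simpa using Nat.one_le_two_pow)
    fun x hx => ⟨0, by simp, by simpa using hbd n x hx⟩⟩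

theorem exists_le_entropyNumber_small {p u v : ℝ≥0∞} (hp : 0 < p) (hp' : p ≠ ⊤) (hu : 0 < u)
    (hv : 0 < v) : ∃ c : ℝ, 0 < c ∧ ∀ n k : ℕ, 0 < n → 1 ≤ k → (k : ℝ) ≤ Real.log ((n : ℝ) + 1) →
      c ≤ entropyNumber n (lorentzNorm n p u) (lorentzNorm n ⊤ v) k := by
  obtain ⟨c, hc, h⟩ := exists_le_entropyNumber_of_blocks hp hp' hu hv
  have hlog : 0 < Real.log (1 + 1) := Real.log_pos (by norm_num)
  refine ⟨c * Real.log (1 + 1) ^ (1 / v).toReal, by positivity, fun n k hn hk hkn => ?_⟩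
  have hn1 : (1 : ℝ) ≤ n := by exact_mod_cast hn
  have h' := h n 1 n k (10 * n) le_rfl (by omega) (by linarith) ?_
  · simpa using h'
  · have h1 : Real.exp k ≤ n + 1 := (Real.le_log_iff_exp_le (by linarith)).1 hkn
    obtain ⟨j, rfl⟩ : ∃ j, k = j + 1 := ⟨k - 1, by omega⟩
    have h2 : (2.7 : ℝ) * 2 ^ j ≤ Real.exp ((j + 1 : ℕ) : ℝ) := by
      have e1 := Real.exp_one_gt_d9
      have e2 : (2 : ℝ) ^ j ≤ Real.exp 1 ^ j := by gcongr; linarith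
      have e3 : Real.exp ((j + 1 : ℕ) : ℝ) = Real.exp 1 * Real.exp 1 ^ j := by
        rw [← Real.exp_nat_mul, ← Real.exp_add]
        congr 1
        push_cast
        ring
      rw [e3]
      gcongr
      linarith
    have h3 : (1 : ℝ) ≤ 2 ^ j := one_le_pow₀ (by norm_num)
    have h4 : (n : ℝ) / (10 * n) = 1 / 10 := by field_simp
    simp only [h4, Nat.add_sub_cancel, pow_one, show 1 / 2 = 0 from rfl, pow_zero]
    linarith

theorem two_pow_mul_block_count_lt {k m b : ℕ} {L : ℝ} (hL : 5 * (k : ℝ) ≤ m * L) (hb : 64 ≤ b)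
    (hbL : L / 2 ≤ Real.log b) :
    (2 : ℝ) ^ (k - 1) * ((b : ℝ) ^ (m / 2) * (1 + b / b) ^ m) < (b : ℝ) ^ m ∨ k = 0 := by
  rcases Nat.eq_zero_or_pos k with hk | hk
  · exact Or.inr hk
  left
  have hb1 : (64 : ℝ) ≤ b := by exact_mod_cast hb
  have hb0 : (0 : ℝ) < b := by linarith
  have hl2 := Real.log_two_lt_d9
  have hl2' : 0 < Real.log 2 := Real.log_pos (by norm_num)
  have h64 : 6 * Real.log 2 ≤ Real.log b := by
    calc 6 * Real.log 2 = Real.log (2 ^ 6) := by rw [Real.log_pow]; norm_num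
      _ ≤ Real.log b := Real.log_le_log (by norm_num) (by linarith)
  have hk0 : (1 : ℝ) ≤ k := by exact_mod_cast hk
  have hm0 : (0 : ℝ) ≤ m := m.cast_nonneg
  have key : ((2 : ℝ) ^ (k - 1 + m)) ^ 2 < (b : ℝ) ^ m := by
    refine (Real.log_lt_log_iff (by positivity) (by positivity)).1 ?_
    simp only [Real.log_pow]
    push_cast [Nat.cast_sub hk]
    have e1 : (m : ℝ) * (6 * Real.log 2) ≤ m * Real.log b := by gcongr
    have e2 : (m : ℝ) * (L / 2) ≤ m * Real.log b := by gcongr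
    have e3 : (k : ℝ) * Real.log 2 ≤ k * 0.7 := by gcongr; linarith
    nlinarith
  have h2 : ((2 : ℝ) ^ (k - 1 + m)) ^ 2 < ((b : ℝ) ^ (m - m / 2)) ^ 2 := by
    refine key.trans_le ?_
    rw [← pow_mul]
    exact pow_le_pow_right₀ (by linarith) (by omega)
  have h3 := lt_of_pow_lt_pow_left₀ 2 (by positivity) h2
  calc (2 : ℝ) ^ (k - 1) * ((b : ℝ) ^ (m / 2) * (1 + b / b) ^ m)
      = (b : ℝ) ^ (m / 2) * 2 ^ (k - 1 + m) := by
        rw [div_self hb0.ne', pow_add]; norm_num; ring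
    _ < (b : ℝ) ^ (m / 2) * (b : ℝ) ^ (m - m / 2) := by gcongr
    _ = (b : ℝ) ^ m := by rw [← pow_add]; congr 1; omega

theorem exists_le_entropyNumber_mid {p u v : ℝ≥0∞} (hp : 0 < p) (hp' : p ≠ ⊤) (hu : 0 < u)
    (hv : 0 < v) : ∃ c : ℝ, 0 < c ∧ ∀ n k : ℕ, 1 ≤ k → Real.log ((n : ℝ) + 1) ≤ k → k ≤ n →
      c * (((k : ℝ) / Real.log ((n : ℝ) / (k : ℝ) + 1)) ^ (-(1 / p).toReal) *
          Real.log ((k : ℝ) / Real.log ((n : ℝ) / (k : ℝ) + 1) + 1) ^ (1 / v).toReal) ≤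
      entropyNumber n (lorentzNorm n p u) (lorentzNorm n ⊤ v) k := by
  obtain ⟨c₁, hc₁, hblock⟩ := exists_le_entropyNumber_of_blocks hp hp' hu hv
  obtain ⟨c₂, hc₂, hlarge⟩ := exists_le_entropyNumber_large hp hp' hu hv
  obtain ⟨B, hB, hbd⟩ := exists_lorentzNorm_top_bound hp hp' hu hv
  have hα := toReal_one_div_pos hp hp'
  set α := (1 / p).toReal
  have hβ : 0 ≤ (1 / v).toReal := ENNReal.toReal_nonneg
  set β := (1 / v).toReal
  refine ⟨min (c₁ * 6 ^ (-α)) (c₂ / 2 * (1 / 7000) ^ α * (1 / 2) ^ β), by positivity,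
    fun n k hk hkn hkn' => ?_⟩
  have hk1 : (1 : ℝ) ≤ k := by exact_mod_cast hk
  have hk0 : (0 : ℝ) < k := by linarith
  have hnk : (k : ℝ) ≤ n := by exact_mod_cast hkn'
  have hn0 : (0 : ℝ) < n := by linarith
  set t : ℝ := (n : ℝ) / k with ht
  have ht1 : 1 ≤ t := (one_le_div hk0).2 hnk
  have htn : t ≤ n := div_le_self hn0.le hk1
  have htk : t * k = n := by rw [ht]; field_simp
  set L := Real.log (t + 1) with hL
  have hL2 : 1 / 2 ≤ L := by
    have := Real.log_two_gt_d9
    have : Real.log 2 ≤ L := Real.log_le_log (by norm_num) (by linarith)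
    linarith
  have hL0 : 0 < L := by linarith
  have hLk : L ≤ k := (Real.log_le_log (by linarith) (by linarith)).trans hkn
  set l : ℝ := (k : ℝ) / L with hl
  have hl1 : 1 ≤ l := (one_le_div hL0).2 hLk
  have hlL : l * L = k := by rw [hl]; field_simp
  have hl0 : 0 < l := by linarith
  have hlog : 0 < Real.log (l + 1) := Real.log_pos (by linarith)
  have he1 := Real.exp_one_lt_d9
  have he2 := Real.exp_one_gt_d9
  rcases le_or_gt 1000 t with htb | hts
  · have hL6 : 6 ≤ L := by
      rw [hL, Real.le_log_iff_exp_le (by linarith)]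
      calc Real.exp 6 = Real.exp 1 ^ 6 := by rw [← Real.exp_nat_mul]; norm_num
        _ ≤ 2.72 ^ 6 := by gcongr; linarith
        _ ≤ t + 1 := by norm_num; linarith
    set m : ℕ := ⌈5 * l⌉₊ with hm
    have hm1 : 5 * l ≤ m := Nat.le_ceil _
    have hm2 : (m : ℝ) ≤ 6 * l := by
      have := (Nat.ceil_lt_add_one (show 0 ≤ 5 * l by positivity)).le
      linarith
    have hm0 : (0 : ℝ) < m := by linarith
    have hmN : 1 ≤ m := by exact_mod_cast hm0
    set b : ℕ := n / m with hb
    have hbt : t ≤ (b : ℝ) + 1 := by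
      have h1 : n < m * (b + 1) := Nat.lt_mul_div_succ n hmN
      have h2 : (n : ℝ) ≤ m * ((b : ℝ) + 1) := by exact_mod_cast h1.le
      have h3 : t * m ≤ n := by
        calc t * m ≤ t * (6 * l) := by gcongr
          _ ≤ t * (L * l) := by gcongr
          _ = n := by rw [← htk, ← hlL]; ring
      have h4 : (m : ℝ) * t ≤ m * ((b : ℝ) + 1) := by linarith
      exact le_of_mul_le_mul_left h4 hm0
    have hb999 : (999 : ℝ) ≤ b := by linarith
    have hb64 : 64 ≤ b := by
      have : 999 ≤ b := by exact_mod_cast hb999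
      omega
    have hbL : L / 2 ≤ Real.log b := by
      have : L ≤ 2 * Real.log b := by
        calc L ≤ Real.log ((b : ℝ) ^ 2) := Real.log_le_log (by linarith) (by nlinarith)
          _ = _ := by rw [Real.log_pow]; norm_num
      linarith
    have hcount := (two_pow_mul_block_count_lt (k := k) (m := m)
      (by nlinarith) hb64 hbL).resolve_right (by omega)
    refine le_trans ?_ (hblock n m b k b hmN (Nat.mul_div_le n m) (by linarith) hcount)
    calc _ ≤ c₁ * 6 ^ (-α) * (l ^ (-α) * Real.log (l + 1) ^ β) := by
          gcongr; exact min_le_left _ _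
      _ = c₁ * ((6 * l) ^ (-α) * Real.log (l + 1) ^ β) := by
          rw [Real.mul_rpow (by norm_num) hl0.le]; ring
      _ ≤ _ := by
          gcongr c₁ * (?_ * ?_)
          · exact Real.rpow_le_rpow_of_nonpos hm0 hm2 (by linarith)
          · refine Real.rpow_le_rpow hlog.le (Real.log_le_log (by linarith) ?_) hβ
            linarith
  · have hL7 : L ≤ 7 := by
      rw [hL, Real.log_le_iff_le_exp (by linarith)]
      calc t + 1 ≤ 2.7 ^ 7 := by norm_num; linarith
        _ ≤ Real.exp 1 ^ 7 := by gcongr; linarith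
        _ = Real.exp 7 := by rw [← Real.exp_nat_mul]; norm_num
    have hln : 1 / 7000 * (n : ℝ) ≤ l := by
      have h1 : (k : ℝ) / 7 ≤ l := by rw [hl]; gcongr
      have h2 : (n : ℝ) ≤ 1000 * k := by rw [← htk]; gcongr
      linarith
    have hln2 : l ≤ 2 * n := by
      rw [hl, div_le_iff₀ hL0]
      nlinarith
    have hloglog : (1 / 2) * Real.log (l + 1) ≤ Real.log ((n : ℝ) + 1) := by
      have : Real.log (l + 1) ≤ 2 * Real.log ((n : ℝ) + 1) := by
        calc Real.log (l + 1) ≤ Real.log (((n : ℝ) + 1) ^ 2) :=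
              Real.log_le_log (by linarith) (by nlinarith)
          _ = _ := by rw [Real.log_pow]; norm_num
      linarith
    refine le_trans ?_ ((hlarge n n (by omega) le_rfl).trans
      (entropyNumber_antitone hkn' hB (hbd n)))
    have h2 : (2 : ℝ) ^ (-(n : ℝ) / n) = 1 / 2 := by
      rw [neg_div, div_self hn0.ne', Real.rpow_neg_one]; norm_num
    rw [h2]
    calc _ ≤ c₂ / 2 * (1 / 7000) ^ α * (1 / 2) ^ β * (l ^ (-α) * Real.log (l + 1) ^ β) := by
          gcongr; exact min_le_right _ _
      _ ≤ c₂ / 2 * (1 / 7000) ^ α * (1 / 2) ^ β *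
          ((1 / 7000 * (n : ℝ)) ^ (-α) * Real.log (l + 1) ^ β) := by
          gcongr _ * (?_ * _)
          exact Real.rpow_le_rpow_of_nonpos (by positivity) hln (by linarith)
      _ = c₂ * (1 / 2 * (n : ℝ) ^ (-α) * ((1 / 2) * Real.log (l + 1)) ^ β) := by
          rw [Real.mul_rpow (by norm_num) hn0.le, Real.mul_rpow (by norm_num) hlog.le,
            Real.rpow_neg (by norm_num) α]
          field_simp
      _ ≤ _ := by gcongr

/-- Case (II) of the main theorem: for `0 < p < ∞`, `q = ∞`, `0 < u, v ≤ ∞`, with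
`ℓ(k,n) = k / log(n/k + 1)`, the entropy numbers `e_k(id : ℓ_{p,u}^n → ℓ_{∞,v}^n)` are,
uniformly in `k` and `n`, equivalent to `1` for `1 ≤ k ≤ log(n+1)`, to
`ℓ(k,n)^{-1/p} (log(ℓ(k,n)+1))^{1/v}` for `log(n+1) ≤ k ≤ n`, and to
`2^{-k/n} n^{-1/p} (log(n+1))^{1/v}` for `k ≥ n`. -/
theorem entropy_lorentz_pu_inftyv
    (p u v : ℝ≥0∞) (hp : 0 < p) (hp' : p ≠ ⊤) (hu : 0 < u) (hv : 0 < v) :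
    ∃ c C : ℝ, 0 < c ∧ 0 < C ∧ ∀ n : ℕ, 0 < n →
      (∀ k : ℕ, 1 ≤ k → (k : ℝ) ≤ Real.log ((n : ℝ) + 1) →
        c ≤ entropyNumber n (lorentzNorm n p u) (lorentzNorm n ⊤ v) k ∧
          entropyNumber n (lorentzNorm n p u) (lorentzNorm n ⊤ v) k ≤ C) ∧
      (∀ k : ℕ, Real.log ((n : ℝ) + 1) ≤ (k : ℝ) → k ≤ n →
        c * (((k : ℝ) / Real.log ((n : ℝ) / (k : ℝ) + 1)) ^ (-(1 / p).toReal) *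
              Real.log ((k : ℝ) / Real.log ((n : ℝ) / (k : ℝ) + 1) + 1) ^ (1 / v).toReal) ≤
            entropyNumber n (lorentzNorm n p u) (lorentzNorm n ⊤ v) k ∧
          entropyNumber n (lorentzNorm n p u) (lorentzNorm n ⊤ v) k ≤
            C * (((k : ℝ) / Real.log ((n : ℝ) / (k : ℝ) + 1)) ^ (-(1 / p).toReal) *
              Real.log ((k : ℝ) / Real.log ((n : ℝ) / (k : ℝ) + 1) + 1) ^ (1 / v).toReal)) ∧
      (∀ k : ℕ, n ≤ k →
        c * ((2 : ℝ) ^ (-(k : ℝ) / (n : ℝ)) * (n : ℝ) ^ (-(1 / p).toReal) *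
              Real.log ((n : ℝ) + 1) ^ (1 / v).toReal) ≤
            entropyNumber n (lorentzNorm n p u) (lorentzNorm n ⊤ v) k ∧
          entropyNumber n (lorentzNorm n p u) (lorentzNorm n ⊤ v) k ≤
            C * ((2 : ℝ) ^ (-(k : ℝ) / (n : ℝ)) * (n : ℝ) ^ (-(1 / p).toReal) *
              Real.log ((n : ℝ) + 1) ^ (1 / v).toReal)) := by
  obtain ⟨c₁, hc₁, h₁⟩ := exists_le_entropyNumber_small hp hp' hu hv
  obtain ⟨c₂, hc₂, h₂⟩ := exists_le_entropyNumber_mid hp hp' hu hv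
  obtain ⟨c₃, hc₃, h₃⟩ := exists_le_entropyNumber_large hp hp' hu hv
  obtain ⟨C₁, hC₁, H₁⟩ := exists_entropyNumber_le_const hp hp' hu hv
  obtain ⟨C₂, hC₂, H₂⟩ := exists_entropyNumber_le_mid hp hp' hu hv
  obtain ⟨C₃, hC₃, H₃⟩ := exists_entropyNumber_le_large hp hp' hu hv
  refine ⟨min c₁ (min c₂ c₃), max C₁ (max C₂ C₃), by positivity, by positivity,
    fun n hn => ⟨fun k hk hkn => ⟨(min_le_left _ _).trans (h₁ n k hn hk hkn),
      (H₁ n k).trans (le_max_left _ _)⟩, fun k hkn hkn' => ?_, fun k hnk => ?_⟩⟩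
  · have hn1 : (1 : ℝ) ≤ n := by exact_mod_cast hn
    have hk0 : (0 : ℝ) < k := (Real.log_pos (by linarith)).trans_le hkn
    have hk : 1 ≤ k := by exact_mod_cast hk0
    have hl : 0 ≤ (k : ℝ) / Real.log ((n : ℝ) / (k : ℝ) + 1) := by
      have : 0 ≤ Real.log ((n : ℝ) / (k : ℝ) + 1) :=
        Real.log_nonneg (le_add_of_nonneg_left (by positivity))
      positivity
    have hl' := Real.log_nonneg (le_add_of_nonneg_left hl)
    refine ⟨le_trans ?_ (h₂ n k hk hkn hkn'), (H₂ n k hk hkn hkn').trans ?_⟩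
    · gcongr
      exact (min_le_right _ _).trans (min_le_left _ _)
    · gcongr
      exact (le_max_left _ _).trans (le_max_right _ _)
  · have hl : 0 ≤ Real.log ((n : ℝ) + 1) := Real.log_nonneg (le_add_of_nonneg_left n.cast_nonneg)
    refine ⟨le_trans ?_ (h₃ n k hn hnk), (H₃ n k hn hnk).trans ?_⟩
    · gcongr
      exact (min_le_right _ _).trans (min_le_right _ _)
    · gcongr
      exact (le_max_right _ _).trans (le_max_right _ _)
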